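/- arXiv:1511.00648 — 9 statements merged into one kernel-verified Lean document; each statement's English description precedes it below -/
import Mathlib

section
/- For every integer d ≥ 1 there exists n₀ depending only on d such that for all even n ≥ n₀ the following holds. Let M be a uniformly random perfect matching of [n]. Then for every multilinear polynomial g of degree at most d on n variables, E_M[ (E_{P(M)}[g²])² ] ≤ 3d · 9^d · ‖g‖₂⁴. -/
open Finset

/-- Evaluation of a multilinear polynomial given its coefficients. -/
noncomputable def evalML {n : ℕ} (c : Finset (Fin n) → ℝ) (x : Fin n → ℝ) : ℝ :=
  ∑ S : Finset (Fin n), c S * ∏ i ∈ S, x i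

/-- The ±1 assignment corresponding to a Boolean assignment. -/
def signs {n : ℕ} (σ : Fin n → Bool) : Fin n → ℝ := fun i => if σ i then 1 else -1

/-- Perfect matchings of `[n]`, encoded as fixed-point-free involutions. -/
def matchSet (n : ℕ) : Finset (Fin n → Fin n) :=
  Finset.univ.filter fun m => (∀ i, m (m i) = i) ∧ ∀ i, m i ≠ i

/-- The support of the distribution `P(M)`: assignments giving opposite signs to the two
elements of each matched pair; `P(M)` is uniform on this set. -/
def pmSet {n : ℕ} (m : Fin n → Fin n) : Finset (Fin n → Bool) :=
  Finset.univ.filter fun σ => ∀ i, σ (m i) = !(σ i)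

/-- Expectation of `g` over the uniform distribution on `A`. -/
noncomputable def expOver {n : ℕ} (A : Finset (Fin n → Bool)) (g : (Fin n → Bool) → ℝ) : ℝ :=
  (∑ σ ∈ A, g σ) / A.card

/-- The character `χ_S` of the Boolean cube. -/
def cubeChar {n : ℕ} (S : Finset (Fin n)) (σ : Fin n → Bool) : ℝ := ∏ i ∈ S, signs σ i

lemma signs_mul_self {n : ℕ} (σ : Fin n → Bool) (i : Fin n) : signs σ i * signs σ i = 1 := by
  unfold signs; split_ifs <;> norm_num

lemma cubeChar_symmDiff {n : ℕ} (S T : Finset (Fin n)) (σ : Fin n → Bool) :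
    cubeChar (symmDiff S T) σ = cubeChar S σ * cubeChar T σ := by
  unfold cubeChar
  rw [← Fintype.prod_ite_mem, ← Fintype.prod_ite_mem S, ← Fintype.prod_ite_mem T,
    ← Finset.prod_mul_distrib]
  refine Finset.prod_congr rfl fun i _ => ?_
  have := signs_mul_self σ i
  by_cases hS : i ∈ S <;> by_cases hT : i ∈ T <;> simp [Finset.mem_symmDiff, hS, hT, this]

lemma cubeChar_singleton {n : ℕ} (i : Fin n) (σ : Fin n → Bool) :
    cubeChar {i} σ = signs σ i := by
  simp [cubeChar]

lemma cubeChar_mul_self {n : ℕ} (S : Finset (Fin n)) (σ : Fin n → Bool) :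
    cubeChar S σ * cubeChar S σ = 1 := by
  rw [← cubeChar_symmDiff, symmDiff_self]; simp [cubeChar]

lemma abs_cubeChar {n : ℕ} (S : Finset (Fin n)) (σ : Fin n → Bool) : |cubeChar S σ| = 1 := by
  have h := cubeChar_mul_self S σ
  rcases mul_self_eq_one_iff.1 h with h | h <;> simp [h]

lemma evalML_signs {n : ℕ} (c : Finset (Fin n) → ℝ) (σ : Fin n → Bool) :
    evalML c (signs σ) = ∑ S, c S * cubeChar S σ := rfl

/-- Sums over `T ∆ S` and over `S` agree. -/
lemma sum_symmDiff_left {ι M : Type*} [Fintype ι] [DecidableEq ι] [AddCommMonoid M]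
    (T : Finset ι) (F : Finset ι → M) : ∑ S, F (symmDiff T S) = ∑ S, F S :=
  Equiv.sum_comp (symmDiff_right_involutive T).toPerm F

lemma sum_symmDiff_right {ι M : Type*} [Fintype ι] [DecidableEq ι] [AddCommMonoid M]
    (T : Finset ι) (F : Finset ι → M) : ∑ S, F (symmDiff S T) = ∑ S, F S := by
  simp_rw [symmDiff_comm _ T]; exact sum_symmDiff_left T F

/-- A function on the cube that is odd in one coordinate sums to zero. -/
lemma sum_eq_zero_of_flip {n : ℕ} (i : Fin n) (F : (Fin n → Bool) → ℝ)
    (hF : ∀ σ, F (Function.update σ i (!(σ i))) = -F σ) : ∑ σ, F σ = 0 := by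
  have hinv : Function.Involutive fun σ : Fin n → Bool => Function.update σ i (!(σ i)) := by
    intro σ; simp
  have h := Equiv.sum_comp hinv.toPerm F
  simp only [Function.Involutive.coe_toPerm, hF, Finset.sum_neg_distrib] at h
  linarith

lemma signs_update_self {n : ℕ} (i : Fin n) (σ : Fin n → Bool) :
    signs (Function.update σ i (!(σ i))) i = -signs σ i := by
  unfold signs; cases h : σ i <;> simp

lemma cubeChar_update_of_notMem {n : ℕ} {i : Fin n} {S : Finset (Fin n)} (hi : i ∉ S)
    (σ : Fin n → Bool) (b : Bool) : cubeChar S (Function.update σ i b) = cubeChar S σ := by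
  refine Finset.prod_congr rfl fun j hj => ?_
  have : j ≠ i := fun h => hi (h ▸ hj)
  simp [signs, this]

lemma cubeChar_insert {n : ℕ} {i : Fin n} {S : Finset (Fin n)} (hi : i ∉ S)
    (σ : Fin n → Bool) : cubeChar (insert i S) σ = signs σ i * cubeChar S σ :=
  Finset.prod_insert hi

lemma sum_cubeChar {n : ℕ} (S : Finset (Fin n)) :
    ∑ σ, cubeChar S σ = if S = ∅ then (2 : ℝ) ^ n else 0 := by
  split_ifs with h
  · simp [h, cubeChar]
  · obtain ⟨i, hi⟩ := Finset.nonempty_iff_ne_empty.2 h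
    refine sum_eq_zero_of_flip i _ fun σ => ?_
    rw [← Finset.insert_erase hi, cubeChar_insert (Finset.notMem_erase i S),
      cubeChar_insert (Finset.notMem_erase i S), signs_update_self,
      cubeChar_update_of_notMem (Finset.notMem_erase i S)]
    ring

/-- Parseval's identity. -/
lemma sum_evalML_sq {n : ℕ} (f : Finset (Fin n) → ℝ) :
    ∑ σ, evalML f (signs σ) ^ 2 = 2 ^ n * ∑ S, f S ^ 2 := by
  simp_rw [evalML_signs, sq, Finset.sum_mul_sum]
  rw [Finset.sum_comm, Finset.mul_sum]
  refine Finset.sum_congr rfl fun S _ => ?_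
  rw [Finset.sum_comm]
  have : ∀ T, ∑ σ, f S * cubeChar S σ * (f T * cubeChar T σ)
      = if S = T then 2 ^ n * (f S * f T) else 0 := by
    intro T
    have h : ∀ σ, f S * cubeChar S σ * (f T * cubeChar T σ)
        = f S * f T * cubeChar (symmDiff S T) σ := by
      intro σ; rw [cubeChar_symmDiff]; ring
    simp_rw [h, ← Finset.mul_sum, sum_cubeChar, Finset.symmDiff_eq_empty]
    split_ifs <;> ring
  simp_rw [this]
  simp

/-- The Bonami inequality for fourth moments, for polynomials in the variables of `A`. -/
lemma bonami_powerset {n : ℕ} (A : Finset (Fin n)) : ∀ (d : ℕ) (c : Finset (Fin n) → ℝ),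
    (∀ S, d < #S → c S = 0) →
    ∑ σ, (∑ S ∈ A.powerset, c S * cubeChar S σ) ^ 4 ≤
      2 ^ n * 9 ^ d * (∑ S ∈ A.powerset, c S ^ 2) ^ 2 := by
  induction A using Finset.induction_on with
  | empty =>
    intro d c _
    have h9 : (1 : ℝ) ≤ 9 ^ d := one_le_pow₀ (by norm_num)
    have h4 : 0 ≤ 2 ^ n * (c ∅ ^ 2) ^ 2 := by positivity
    simp [cubeChar]
    nlinarith
  | insert i A hi ih =>
    intro d c hc
    have hnot : ∀ S ∈ A.powerset, i ∉ S := fun S hS h => hi (Finset.mem_powerset.1 hS h)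
    set a : (Fin n → Bool) → ℝ := fun σ => ∑ S ∈ A.powerset, c S * cubeChar S σ with ha
    set b : (Fin n → Bool) → ℝ := fun σ => ∑ S ∈ A.powerset, c (insert i S) * cubeChar S σ with hb
    set p := ∑ S ∈ A.powerset, c S ^ 2 with hp
    set q := ∑ S ∈ A.powerset, c (insert i S) ^ 2 with hq
    have hp0 : 0 ≤ p := Finset.sum_nonneg fun _ _ => sq_nonneg _
    have hq0 : 0 ≤ q := Finset.sum_nonneg fun _ _ => sq_nonneg _
    have hA : ∑ σ, a σ ^ 4 ≤ 2 ^ n * 9 ^ d * p ^ 2 := ih d c hc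
    have hflip : ∀ (e : Finset (Fin n) → ℝ) (σ : Fin n → Bool) (β : Bool),
        ∑ S ∈ A.powerset, e S * cubeChar S (Function.update σ i β)
          = ∑ S ∈ A.powerset, e S * cubeChar S σ := fun e σ β =>
      Finset.sum_congr rfl fun S hS => by rw [cubeChar_update_of_notMem (hnot S hS)]
    have hsplit : ∀ σ, ∑ S ∈ (insert i A).powerset, c S * cubeChar S σ = a σ + signs σ i * b σ := by
      intro σ
      rw [Finset.sum_powerset_insert hi, ha, hb, Finset.mul_sum]
      congr 1
      refine Finset.sum_congr rfl fun S hS => ?_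
      rw [cubeChar_insert (hnot S hS)]; ring
    have hodd : ∑ σ, signs σ i * (4 * a σ ^ 3 * b σ + 4 * a σ * b σ ^ 3) = 0 := by
      refine sum_eq_zero_of_flip i _ fun σ => ?_
      rw [signs_update_self, ha, hb]
      simp only [hflip]
      ring
    have hexp : ∑ σ, (∑ S ∈ (insert i A).powerset, c S * cubeChar S σ) ^ 4
        = ∑ σ, a σ ^ 4 + 6 * ∑ σ, a σ ^ 2 * b σ ^ 2 + ∑ σ, b σ ^ 4 := by
      rw [← add_zero (∑ σ, a σ ^ 4 + _ + _), ← hodd, Finset.mul_sum, ← Finset.sum_add_distrib,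
        ← Finset.sum_add_distrib, ← Finset.sum_add_distrib]
      refine Finset.sum_congr rfl fun σ _ => ?_
      rw [hsplit]
      have h2 : signs σ i ^ 2 = 1 := by rw [sq, signs_mul_self]
      have h3 : signs σ i ^ 3 = signs σ i := by rw [pow_succ, h2, one_mul]
      have h4 : signs σ i ^ 4 = 1 := by rw [pow_succ, h3, signs_mul_self]
      calc (a σ + signs σ i * b σ) ^ 4 = a σ ^ 4 + 4 * a σ ^ 3 * b σ * signs σ i
            + 6 * a σ ^ 2 * b σ ^ 2 * signs σ i ^ 2 + 4 * a σ * b σ ^ 3 * signs σ i ^ 3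
            + b σ ^ 4 * signs σ i ^ 4 := by ring
        _ = _ := by rw [h2, h3, h4]; ring
    rw [hexp, Finset.sum_powerset_insert hi]
    change _ ≤ 2 ^ n * 9 ^ d * (p + q) ^ 2
    rcases d with _ | d
    · have hz : ∀ S, c (insert i S) = 0 := fun S =>
        hc _ (Finset.card_pos.2 (Finset.insert_nonempty i S))
      have hb0 : ∀ σ, b σ = 0 := fun σ => by simp [hb, hz]
      have hq' : q = 0 := by simp [hq, hz]
      simpa [hb0, hq'] using hA
    · have hcd : ∑ σ, b σ ^ 4 ≤ 2 ^ n * 9 ^ d * q ^ 2 := by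
        have := ih d (fun S => if i ∈ S then 0 else c (insert i S)) fun S hS => by
          split_ifs with h
          · rfl
          · exact hc _ (by rw [Finset.card_insert_of_notMem h]; omega)
        convert this using 3
        · exact Finset.sum_congr rfl fun S hS => by rw [if_neg (hnot S hS)]
        · exact Finset.sum_congr rfl fun S hS => by rw [if_neg (hnot S hS)]
      have hcs : ∑ σ, a σ ^ 2 * b σ ^ 2 ≤ 2 ^ n * 9 ^ d * 3 * p * q := by
        refine le_of_abs_le (abs_le_of_sq_le_sq ?_ (by positivity))
        refine (Finset.sum_mul_sq_le_sq_mul_sq _ _ _).trans ?_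
        simp_rw [← pow_mul]
        refine (mul_le_mul hA hcd (Finset.sum_nonneg fun σ _ => ?_) (by positivity)).trans_eq
          (by ring)
        exact Even.pow_nonneg (by decide) _
      calc _ ≤ 2 ^ n * 9 ^ (d + 1) * p ^ 2 + 6 * (2 ^ n * 9 ^ d * 3 * p * q)
            + 2 ^ n * 9 ^ d * q ^ 2 := by gcongr
        _ ≤ _ := by
          have : 0 ≤ (2 : ℝ) ^ n * 9 ^ d * q ^ 2 := by positivity
          rw [pow_succ]
          nlinarith

/-- The coefficients of the square of a multilinear polynomial on the cube. -/
def sqCoeff {n : ℕ} (c : Finset (Fin n) → ℝ) (U : Finset (Fin n)) : ℝ :=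
  ∑ S, c S * c (symmDiff S U)

lemma evalML_sqCoeff {n : ℕ} (c : Finset (Fin n) → ℝ) (σ : Fin n → Bool) :
    evalML (sqCoeff c) (signs σ) = evalML c (signs σ) ^ 2 := by
  simp_rw [evalML_signs, sq, Finset.sum_mul_sum, sqCoeff, Finset.sum_mul]
  rw [Finset.sum_comm]
  refine Finset.sum_congr rfl fun S _ => ?_
  rw [← sum_symmDiff_left S]
  refine Finset.sum_congr rfl fun T _ => ?_
  rw [symmDiff_symmDiff_cancel_left, cubeChar_symmDiff]
  ring

lemma sqCoeff_eq_zero {n d : ℕ} {c : Finset (Fin n) → ℝ} (hc : ∀ S, d < #S → c S = 0)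
    {U : Finset (Fin n)} (hU : 2 * d < #U) : sqCoeff c U = 0 := by
  refine Finset.sum_eq_zero fun S _ => ?_
  by_cases hS : d < #S
  · rw [hc S hS, zero_mul]
  · rw [hc (symmDiff S U), mul_zero]
    have h : U \ S ⊆ symmDiff S U := Finset.symmDiff_subset_sdiff'
    have h1 := Finset.card_le_card h
    have h2 := Finset.le_card_sdiff S U
    omega

lemma sum_sqCoeff_sq_le {n d : ℕ} {c : Finset (Fin n) → ℝ} (hc : ∀ S, d < #S → c S = 0) :
    ∑ U, sqCoeff c U ^ 2 ≤ 9 ^ d * (∑ S, c S ^ 2) ^ 2 := by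
  have h := bonami_powerset Finset.univ d c hc
  have h2 := sum_evalML_sq (sqCoeff c)
  simp_rw [evalML_sqCoeff, ← pow_mul] at h2
  simp only [Finset.powerset_univ, ← evalML_signs, h2] at h
  rw [mul_assoc] at h
  exact le_of_mul_le_mul_left h (by positivity)

/-- The raising operator on coefficients: the degree-raising part of multiplication by `∑ i, x i`. -/
def raising {n : ℕ} (f : Finset (Fin n) → ℝ) (S : Finset (Fin n)) : ℝ :=
  ∑ i ∈ S, f (symmDiff S {i})

/-- The lowering operator on coefficients, adjoint to `raising`. -/
def lowering {n : ℕ} (f : Finset (Fin n) → ℝ) (S : Finset (Fin n)) : ℝ :=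
  ∑ i ∈ Sᶜ, f (symmDiff S {i})

lemma symmDiff_singleton_of_mem {ι : Type*} [DecidableEq ι] {S : Finset ι} {i : ι} (h : i ∈ S) :
    symmDiff S {i} = S.erase i := by
  ext j; by_cases hj : j = i <;> simp [Finset.mem_symmDiff, hj, h]

lemma symmDiff_singleton_of_notMem {ι : Type*} [DecidableEq ι] {S : Finset ι} {i : ι}
    (h : i ∉ S) : symmDiff S {i} = insert i S := by
  ext j; by_cases hj : j = i <;> simp [Finset.mem_symmDiff, hj, h]

lemma card_symmDiff_singleton_of_mem {ι : Type*} [DecidableEq ι] {S : Finset ι} {i : ι}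
    (h : i ∈ S) : #(symmDiff S {i}) + 1 = #S := by
  rw [symmDiff_singleton_of_mem h, Finset.card_erase_add_one h]

lemma card_symmDiff_singleton_of_notMem {ι : Type*} [DecidableEq ι] {S : Finset ι} {i : ι}
    (h : i ∉ S) : #(symmDiff S {i}) = #S + 1 := by
  rw [symmDiff_singleton_of_notMem h, Finset.card_insert_of_notMem h]

lemma raising_add_lowering {n : ℕ} (f : Finset (Fin n) → ℝ) (S : Finset (Fin n)) :
    raising f S + lowering f S = ∑ i, f (symmDiff S {i}) :=
  Finset.sum_add_sum_compl S _

lemma raising_sub_lowering {n : ℕ} (f : Finset (Fin n) → ℝ) (S : Finset (Fin n)) :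
    raising f S - lowering f S = ∑ i, (if i ∈ S then 1 else -1) * f (symmDiff S {i}) := by
  rw [← Finset.sum_add_sum_compl S, sub_eq_add_neg, raising, lowering, ← Finset.sum_neg_distrib]
  congr 1 <;> refine Finset.sum_congr rfl fun i hi => ?_
  · simp [hi]
  · simp [Finset.mem_compl.1 hi]

lemma raising_eq_zero {n k : ℕ} {f : Finset (Fin n) → ℝ} (hf : ∀ S, #S ≠ k → f S = 0)
    {S : Finset (Fin n)} (hS : #S ≠ k + 1) : raising f S = 0 :=
  Finset.sum_eq_zero fun i hi => hf _ (by have := card_symmDiff_singleton_of_mem hi; omega)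

lemma lowering_eq_zero {n k : ℕ} {f : Finset (Fin n) → ℝ} (hf : ∀ S, #S ≠ k → f S = 0)
    {S : Finset (Fin n)} (hS : #S + 1 ≠ k) : lowering f S = 0 :=
  Finset.sum_eq_zero fun i hi => hf _ (by
    have := card_symmDiff_singleton_of_notMem (Finset.mem_compl.1 hi); omega)

/-- The commutation relation between `raising` and `lowering`, in quadratic form. -/
lemma sum_raising_sq_sub_sum_lowering_sq {n : ℕ} (f : Finset (Fin n) → ℝ) :
    ∑ S, raising f S ^ 2 - ∑ S, lowering f S ^ 2 = ∑ S, ((n : ℝ) - 2 * #S) * f S ^ 2 := by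
  have key : ∀ i j : Fin n, ∑ S : Finset (Fin n), f (symmDiff S {i}) *
      ((if j ∈ S then 1 else -1) * f (symmDiff S {j}))
      = if j = i then ∑ S : Finset (Fin n), (if j ∈ S then -1 else 1) * f S ^ 2 else 0 := by
    intro i j
    split_ifs with h
    · subst h
      rw [← sum_symmDiff_right {j}]
      refine Finset.sum_congr rfl fun S _ => ?_
      rw [symmDiff_symmDiff_cancel_right]
      by_cases hj : j ∈ S <;> simp [Finset.mem_symmDiff, hj] <;> ring
    · have hneg : ∀ S : Finset (Fin n),
          f (symmDiff (symmDiff S {i, j}) {i}) * ((if j ∈ symmDiff S {i, j} then 1 else -1) *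
            f (symmDiff (symmDiff S {i, j}) {j}))
          = -(f (symmDiff S {i}) * ((if j ∈ S then 1 else -1) * f (symmDiff S {j}))) := by
        intro S
        have h1 : symmDiff (symmDiff S {i, j}) {i} = symmDiff S {j} := by
          rw [symmDiff_assoc]; congr 1
          ext x; simp only [Finset.mem_symmDiff, Finset.mem_insert, Finset.mem_singleton]; grind
        have h2 : symmDiff (symmDiff S {i, j}) {j} = symmDiff S {i} := by
          rw [symmDiff_assoc]; congr 1
          ext x; simp only [Finset.mem_symmDiff, Finset.mem_insert, Finset.mem_singleton]; grind
        rw [h1, h2]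
        by_cases hj : j ∈ S <;> simp [Finset.mem_symmDiff, hj] <;> ring
      have := sum_symmDiff_right {i, j} fun S : Finset (Fin n) =>
        f (symmDiff S {i}) * ((if j ∈ S then 1 else -1) * f (symmDiff S {j}))
      simp only [hneg, Finset.sum_neg_distrib] at this
      linarith
  have hpt : ∀ S, raising f S ^ 2 - lowering f S ^ 2 = ∑ i, ∑ j, f (symmDiff S {i}) *
      ((if j ∈ S then 1 else -1) * f (symmDiff S {j})) := by
    intro S
    rw [← Finset.sum_mul_sum, ← raising_add_lowering, ← raising_sub_lowering]; ring
  rw [← Finset.sum_sub_distrib]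
  simp_rw [hpt]
  rw [Finset.sum_comm]
  calc _ = ∑ i : Fin n, ∑ j : Fin n, if j = i then
        ∑ S : Finset (Fin n), (if j ∈ S then -1 else 1) * f S ^ 2 else 0 := by
        refine Finset.sum_congr rfl fun i _ => ?_
        rw [Finset.sum_comm]
        exact Finset.sum_congr rfl fun j _ => key i j
    _ = ∑ S : Finset (Fin n), (∑ i : Fin n, if i ∈ S then (-1 : ℝ) else 1) * f S ^ 2 := by
        simp only [Finset.sum_ite_eq', Finset.mem_univ, if_true]
        rw [Finset.sum_comm]
        simp_rw [Finset.sum_mul]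
    _ = _ := by
        refine Finset.sum_congr rfl fun S _ => ?_
        congr 1
        have : ∀ i, (if i ∈ S then (-1 : ℝ) else 1) = 1 - 2 * (if i ∈ S then 1 else 0) := by
          intro i; split_ifs <;> norm_num
        simp_rw [this, Finset.sum_sub_distrib, ← Finset.mul_sum]
        simp

lemma sum_lowering_sq_le {n k : ℕ} (hk : 2 * k ≤ n) {f : Finset (Fin n) → ℝ}
    (hf : ∀ S, #S ≠ k → f S = 0) : ∑ S, lowering f S ^ 2 ≤ ∑ S, raising f S ^ 2 := by
  rw [← sub_nonneg, sum_raising_sq_sub_sum_lowering_sq]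
  refine Finset.sum_nonneg fun S _ => ?_
  by_cases hS : #S = k
  · have : (2 * k : ℝ) ≤ n := by exact_mod_cast hk
    rw [hS]
    exact mul_nonneg (by linarith) (sq_nonneg _)
  · simp [hf S hS]

lemma sum_mul_lowering {n : ℕ} (f h : Finset (Fin n) → ℝ) :
    ∑ S, f S * lowering h S = ∑ S, raising f S * h S := by
  simp only [raising, lowering, Finset.mul_sum, Finset.sum_mul]
  have h1 : ∀ S : Finset (Fin n), ∑ i ∈ Sᶜ, f S * h (symmDiff S {i})
      = ∑ i, if i ∈ S then 0 else f S * h (symmDiff S {i}) := by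
    intro S; 
    rw [← Finset.sum_add_sum_compl S, Finset.sum_eq_zero fun i hi => if_pos hi, zero_add]
    exact Finset.sum_congr rfl fun i hi => (if_neg (Finset.mem_compl.1 hi)).symm
  have h2 : ∀ S : Finset (Fin n), ∑ i ∈ S, f (symmDiff S {i}) * h S
      = ∑ i, if i ∈ S then f (symmDiff S {i}) * h S else 0 := by
    intro S; simp
  simp_rw [h1, h2]
  rw [Finset.sum_comm, Finset.sum_comm (s := Finset.univ (α := Finset (Fin n)))]
  refine Finset.sum_congr rfl fun i _ => ?_
  rw [← sum_symmDiff_right {i}]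
  refine Finset.sum_congr rfl fun S _ => ?_
  rw [symmDiff_symmDiff_cancel_right]
  by_cases hi : i ∈ S <;> simp [Finset.mem_symmDiff, hi]

/-- Every function on the `k`-th level is a harmonic function plus a raised function. -/
lemma exists_harmonic_add_raising {n k : ℕ} {f : Finset (Fin n) → ℝ}
    (hf : ∀ S, #S ≠ k → f S = 0) :
    ∃ h g : Finset (Fin n) → ℝ, (∀ S, #S ≠ k → h S = 0) ∧ (∀ S, #S + 1 ≠ k → g S = 0) ∧
      (∀ S, lowering h S = 0) ∧ (∀ S, f S = h S + raising g S) ∧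
      ∑ S, f S ^ 2 = ∑ S, h S ^ 2 + ∑ S, raising g S ^ 2 := by
  let mask : (Finset (Fin n) → ℝ) → Finset (Fin n) → ℝ := fun g S => if #S + 1 = k then g S else 0
  let U : EuclideanSpace ℝ (Finset (Fin n)) →ₗ[ℝ] EuclideanSpace ℝ (Finset (Fin n)) :=
    { toFun := fun g => WithLp.toLp 2 (raising (mask g))
      map_add' := fun x y => by
        ext S
        simp only [raising, mask, PiLp.add_apply, ← Finset.sum_add_distrib]
        exact Finset.sum_congr rfl fun i _ => by split_ifs <;> simp
      map_smul' := fun r x => by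
        ext S
        simp only [raising, mask, PiLp.smul_apply, Finset.smul_sum, RingHom.id_apply]
        exact Finset.sum_congr rfl fun i _ => by split_ifs <;> simp }
  obtain ⟨_, ⟨g, rfl⟩, h, hh, hfe⟩ :=
    (LinearMap.range U).exists_add_mem_mem_orthogonal (WithLp.toLp 2 f)
  have horth : ∀ e : Finset (Fin n) → ℝ, ∑ S, raising (mask e) S * h S = 0 := by
    intro e
    have := hh (U (WithLp.toLp 2 e)) ⟨_, rfl⟩
    rw [PiLp.inner_apply] at this
    rw [← this]
    exact Finset.sum_congr rfl fun S _ => by simp [U, mul_comm]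
  have hfS : ∀ S, f S = h S + raising (mask g) S := fun S => by
    have := congrArg (fun v : EuclideanSpace ℝ (Finset (Fin n)) => v S) hfe
    simpa [U, add_comm] using this
  have hmask : ∀ S, #S + 1 ≠ k → mask g S = 0 := fun S hS => if_neg hS
  have hh0 : ∀ S, #S ≠ k → h S = 0 := fun S hS => by
    have h1 := hfS S
    rw [hf S hS] at h1
    have h2 : raising (mask g) S = 0 := Finset.sum_eq_zero fun i hi =>
      hmask _ (by rw [card_symmDiff_singleton_of_mem hi]; exact hS)
    linarith
  refine ⟨h, mask g, hh0, hmask, fun R => ?_, hfS, ?_⟩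
  · by_cases hR : #R + 1 = k
    · have := horth fun S => if S = R then 1 else 0
      rw [← sum_mul_lowering, Finset.sum_eq_single R] at this
      · simpa [mask, hR] using this
      · intro S _ hS; simp [mask, hS]
      · simp
    · exact lowering_eq_zero hh0 hR
  · rw [← Finset.sum_add_distrib, ← sub_eq_zero, ← Finset.sum_sub_distrib]
    calc _ = 2 * ∑ S, raising (mask g) S * h S := by
          rw [Finset.mul_sum]
          exact Finset.sum_congr rfl fun S _ => by rw [hfS]; ring
      _ = 0 := by rw [horth, mul_zero]

/-- The sums of a harmonic function of level `k` over the sets containing a fixed small set. -/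
lemma sum_superset_harmonic {n k : ℕ} {h : Finset (Fin n) → ℝ} (hk : ∀ S, #S ≠ k → h S = 0)
    (hl : ∀ S, lowering h S = 0) : ∀ (j : ℕ) (R : Finset (Fin n)), #R + j + 1 = k →
      ∑ S, (if R ⊆ S then h S else 0) = 0 := by
  have hcount : ∀ R : Finset (Fin n), #R < k →
      ((k : ℝ) - #R) * ∑ S, (if R ⊆ S then h S else 0)
        = ∑ i ∈ Rᶜ, ∑ S, (if insert i R ⊆ S then h S else 0) := by
    intro R hR
    rw [Finset.sum_comm, Finset.mul_sum]
    refine Finset.sum_congr rfl fun S _ => ?_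
    by_cases hS : #S = k
    · by_cases hRS : R ⊆ S
      · have : ∑ i ∈ Rᶜ, (if insert i R ⊆ S then h S else 0) = ∑ i ∈ S \ R, h S := by
          rw [← Finset.sum_filter]
          refine Finset.sum_congr ?_ fun _ _ => rfl
          ext i
          simp [Finset.insert_subset_iff, hRS, and_comm]
        rw [this, Finset.sum_const, Finset.card_sdiff_of_subset hRS, if_pos hRS, nsmul_eq_mul, hS,
          Nat.cast_sub hR.le]
      · rw [if_neg hRS, mul_zero, Finset.sum_eq_zero]
        intro i _
        rw [if_neg fun h => hRS ((Finset.subset_insert i R).trans h)]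
    · simp [hk S hS]
  intro j
  induction j with
  | zero =>
    intro R hR
    have h1 := hcount R (by omega)
    have h2 : ∀ i ∈ Rᶜ, ∑ S, (if insert i R ⊆ S then h S else 0) = h (symmDiff R {i}) := by
      intro i hi
      rw [Finset.mem_compl] at hi
      rw [symmDiff_singleton_of_notMem hi, Finset.sum_eq_single (insert i R)]
      · simp
      · intro S _ hS
        split_ifs with hsub
        · refine hk S fun hc => hS (Finset.eq_of_subset_of_card_le hsub ?_).symm
          rw [Finset.card_insert_of_notMem hi]; omega
        · rfl
      · simp
    rw [Finset.sum_congr rfl h2] at h1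
    change _ = lowering h R at h1
    rw [hl] at h1
    refine (mul_eq_zero.1 h1).resolve_left ?_
    rw [← hR]; push_cast; ring_nf; norm_num
  | succ j ih =>
    intro R hR
    have h1 := hcount R (by omega)
    rw [Finset.sum_eq_zero fun i hi => ih (insert i R) (by
      rw [Finset.card_insert_of_notMem (Finset.mem_compl.1 hi)]; omega)] at h1
    refine (mul_eq_zero.1 h1).resolve_left ?_
    rw [← hR]; push_cast; ring_nf; positivity

/-- A harmonic function of level `k`, paired with a function of the size of the intersection with
a set of size at most `k`. -/
lemma sum_harmonic_mul {n k : ℕ} {h : Finset (Fin n) → ℝ} (hk : ∀ S, #S ≠ k → h S = 0)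
    (hl : ∀ S, lowering h S = 0) (ψ : ℕ → ℝ) {T : Finset (Fin n)} (hT : #T ≤ k) :
    ∑ S, h S * ψ #(S ∩ T) = (fwdDiff 1)^[k] ψ 0 * h T := by
  have newton : ∀ S : Finset (Fin n), ψ #(S ∩ T) = ∑ r ∈ Finset.range (k + 1),
      (fwdDiff 1)^[r] ψ 0 * ∑ R ∈ T.powersetCard r, (if R ⊆ S then (1 : ℝ) else 0) := by
    intro S
    have hle : #(S ∩ T) ≤ k := (Finset.card_le_card Finset.inter_subset_right).trans hT
    have h1 := shift_eq_sum_fwdDiff_iter 1 ψ #(S ∩ T) 0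
    simp only [zero_add, smul_eq_mul, mul_one, nsmul_eq_mul] at h1
    rw [h1]
    refine Finset.sum_subset_zero_on_sdiff (Finset.range_mono (by omega)) ?_ ?_
    · intro r hr
      simp only [Finset.mem_sdiff, Finset.mem_range, not_lt] at hr
      rw [Finset.sum_eq_zero, mul_zero]
      intro R hR
      rw [Finset.mem_powersetCard] at hR
      refine if_neg fun hRS => ?_
      have := Finset.card_le_card (Finset.subset_inter hRS hR.1)
      omega
    · intro r _
      rw [mul_comm, ← Finset.sum_filter, Finset.sum_const, nsmul_one]
      congr 2
      rw [← Finset.card_powersetCard]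
      congr 1
      ext R
      simp only [Finset.mem_powersetCard, Finset.mem_filter, Finset.subset_inter_iff]
      tauto
  simp_rw [newton, Finset.mul_sum]
  rw [Finset.sum_comm]
  have hterm : ∀ r ∈ Finset.range (k + 1), ∑ S, ∑ R ∈ T.powersetCard r,
      h S * ((fwdDiff 1)^[r] ψ 0 * (if R ⊆ S then (1 : ℝ) else 0))
      = if r = k then (fwdDiff 1)^[k] ψ 0 * h T else 0 := by
    intro r hr
    rw [Finset.sum_comm]
    have hinner : ∀ R, ∑ S, h S * ((fwdDiff 1)^[r] ψ 0 * (if R ⊆ S then (1 : ℝ) else 0))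
        = (fwdDiff 1)^[r] ψ 0 * ∑ S, (if R ⊆ S then h S else 0) := by
      intro R
      rw [Finset.mul_sum]
      exact Finset.sum_congr rfl fun S _ => by split_ifs <;> ring
    simp_rw [hinner]
    split_ifs with hrk
    · subst hrk
      rcases hT.lt_or_eq with hlt | heq
      · rw [Finset.powersetCard_eq_empty.2 hlt, hk T hlt.ne]; simp
      · rw [← heq, Finset.powersetCard_self, Finset.sum_singleton]
        congr 1
        rw [Finset.sum_eq_single T]
        · simp
        · intro S _ hS
          split_ifs with hsub
          · exact hk S fun hc => hS (Finset.eq_of_subset_of_card_le hsub (by omega)).symm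
          · rfl
        · simp
    · refine Finset.sum_eq_zero fun R hR => ?_
      rw [Finset.mem_powersetCard] at hR
      rw [Finset.mem_range] at hr
      rw [sum_superset_harmonic hk hl (k - r - 1) R (by omega), mul_zero]
  rw [Finset.sum_congr rfl hterm]
  simp

lemma card_symmDiff_add_two_mul_card_inter {ι : Type*} [DecidableEq ι] (S T : Finset ι) :
    #(symmDiff S T) + 2 * #(S ∩ T) = #S + #T := by
  have h1 := Finset.card_sdiff_add_card_inter S T
  have h2 := Finset.card_sdiff_add_card_inter T S
  rw [Finset.inter_comm T S] at h2
  have h3 : #(symmDiff S T) = #(S \ T) + #(T \ S) := by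
    rw [Finset.symmDiff_def]; exact Finset.card_union_of_disjoint disjoint_sdiff_sdiff
  omega

/-- A symmetric weight of mass at most one supported on the balanced points of the cube, together
with its character moments `α`. -/
structure IsBalancedWeight {n : ℕ} (w : (Fin n → Bool) → ℝ) (α : ℕ → ℝ) : Prop where
  nonneg : ∀ σ, 0 ≤ w σ
  sum_le : ∑ σ, w σ ≤ 1
  balanced : ∀ σ, w σ ≠ 0 → ∑ i, signs σ i = 0
  moment : ∀ S : Finset (Fin n), ∑ σ, w σ * cubeChar S σ = α #S

namespace IsBalancedWeight

variable {n : ℕ} {w : (Fin n → Bool) → ℝ} {α : ℕ → ℝ}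

lemma exists_card_eq {t : ℕ} (ht : t ≤ n) : ∃ S : Finset (Fin n), #S = t := by
  obtain ⟨S, _, hS⟩ := Finset.exists_subset_card_eq (s := (Finset.univ : Finset (Fin n)))
    (by simpa using ht)
  exact ⟨S, hS⟩

lemma abs_moment_le_one (hw : IsBalancedWeight w α) {t : ℕ} (ht : t ≤ n) : |α t| ≤ 1 := by
  obtain ⟨S, rfl⟩ := exists_card_eq ht
  rw [← hw.moment]
  refine (Finset.abs_sum_le_sum_abs _ _).trans (le_trans (le_of_eq ?_) hw.sum_le)
  exact Finset.sum_congr rfl fun σ _ => by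
    rw [abs_mul, abs_cubeChar, mul_one, abs_of_nonneg (hw.nonneg σ)]

lemma moment_succ (hw : IsBalancedWeight w α) {t : ℕ} (ht : t ≤ n) :
    t * α (t - 1) + ((n : ℝ) - t) * α (t + 1) = 0 := by
  obtain ⟨S, rfl⟩ := exists_card_eq ht
  have h1 : ∑ σ, w σ * (cubeChar S σ * ∑ i, signs σ i) = 0 := by
    refine Finset.sum_eq_zero fun σ _ => ?_
    by_cases h : w σ = 0
    · rw [h, zero_mul]
    · rw [hw.balanced σ h, mul_zero, mul_zero]
  have h2 : ∑ σ, w σ * (cubeChar S σ * ∑ i, signs σ i) = ∑ i, α #(symmDiff S {i}) := by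
    simp_rw [← hw.moment, cubeChar_symmDiff, cubeChar_singleton, Finset.mul_sum]
    exact Finset.sum_comm
  have h3 : ∑ i ∈ S, α #(symmDiff S {i}) = #S * α (#S - 1) := by
    rw [← nsmul_eq_mul, ← Finset.sum_const]
    exact Finset.sum_congr rfl fun i hi => by
      rw [Nat.eq_sub_of_add_eq (card_symmDiff_singleton_of_mem hi)]
  have h4 : ∑ i ∈ Sᶜ, α #(symmDiff S {i}) = ((n : ℝ) - #S) * α (#S + 1) := by
    have hcard : ((n : ℝ) - #S) = #Sᶜ := by
      rw [Finset.card_compl, Fintype.card_fin, Nat.cast_sub ht]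
    rw [hcard, ← nsmul_eq_mul, ← Finset.sum_const]
    exact Finset.sum_congr rfl fun i hi => by
      rw [card_symmDiff_singleton_of_notMem (Finset.mem_compl.1 hi)]
  rw [← h3, ← h4, Finset.sum_add_sum_compl, ← h2, h1]

lemma moment_odd (hw : IsBalancedWeight w α) (j : ℕ) (hj : 2 * j + 1 ≤ n) :
    α (2 * j + 1) = 0 := by
  have hpos : (0 : ℝ) < n - (2 * j : ℕ) := by
    rw [sub_pos]; exact_mod_cast hj
  have h := hw.moment_succ (t := 2 * j) (by omega)
  induction j with
  | zero =>
    have hn : n ≠ 0 := by omega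
    simpa [hn] using h
  | succ j ih =>
    have h0 : α (2 * (j + 1) - 1) = 0 := ih (by omega)
      (by rw [sub_pos]; exact_mod_cast (by omega : 2 * j < n)) (hw.moment_succ (by omega))
    rw [h0, mul_zero, zero_add] at h
    exact (mul_eq_zero.1 h).resolve_left hpos.ne'

lemma abs_moment_le (hw : IsBalancedWeight w α) {t m : ℕ} (h1 : 1 ≤ t) (htm : t ≤ m)
    (hm : m < n) : |α t| ≤ m / ((n : ℝ) - m) := by
  obtain ⟨s, rfl⟩ : ∃ s, t = s + 1 := ⟨t - 1, by omega⟩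
  have hmn : (m : ℝ) < n := by exact_mod_cast hm
  have hsm : (s : ℝ) + 1 ≤ m := by exact_mod_cast htm
  have h := hw.moment_succ (t := s) (by omega)
  have habs : ((n : ℝ) - s) * |α (s + 1)| = s * |α (s - 1)| := by
    rw [← abs_of_pos (by linarith : (0 : ℝ) < n - s), ← abs_mul, ← Nat.abs_cast s, ← abs_mul,
      Nat.abs_cast, eq_neg_of_add_eq_zero_right h, abs_neg]
  have h3 := hw.abs_moment_le_one (t := s - 1) (by omega)
  rw [le_div_iff₀ (by linarith)]
  have h4 : (s : ℝ) * |α (s - 1)| ≤ s := mul_le_of_le_one_right (Nat.cast_nonneg s) h3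
  nlinarith [abs_nonneg (α (s + 1))]

lemma sum_mul_evalML_mul (hw : IsBalancedWeight w α) (f g : Finset (Fin n) → ℝ) :
    ∑ σ, w σ * (evalML f (signs σ) * evalML g (signs σ))
      = ∑ T, g T * ∑ S, f S * α #(symmDiff S T) := by
  simp_rw [evalML_signs, Finset.sum_mul_sum, ← hw.moment, Finset.mul_sum]
  rw [Finset.sum_comm]
  conv_rhs => rw [Finset.sum_comm]
  refine Finset.sum_congr rfl fun S _ => ?_
  rw [Finset.sum_comm]
  refine Finset.sum_congr rfl fun T _ => Finset.sum_congr rfl fun σ _ => ?_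
  rw [cubeChar_symmDiff]; ring

lemma sum_harmonic_mul_evalML (hw : IsBalancedWeight w α) {k t : ℕ}
    {h g : Finset (Fin n) → ℝ} (hk : ∀ S, #S ≠ k → h S = 0) (hl : ∀ S, lowering h S = 0)
    (ht : t ≤ k) (hg : ∀ S, #S ≠ t → g S = 0) :
    ∑ σ, w σ * (evalML h (signs σ) * evalML g (signs σ))
      = (fwdDiff 1)^[k] (fun s => α (k + t - 2 * s)) 0 * ∑ S, h S * g S := by
  rw [hw.sum_mul_evalML_mul, Finset.mul_sum]
  refine Finset.sum_congr rfl fun T _ => ?_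
  by_cases hT : #T = t
  · have h1 : ∀ S, h S * α #(symmDiff S T) = h S * (fun s => α (k + t - 2 * s)) #(S ∩ T) := by
      intro S
      by_cases hS : #S = k
      · have := card_symmDiff_add_two_mul_card_inter S T
        simp only
        rw [← hS, ← hT, ← this, Nat.add_sub_cancel]
      · simp [hk S hS]
    rw [Finset.sum_congr rfl fun S _ => h1 S,
      sum_harmonic_mul hk hl (fun s => α (k + t - 2 * s)) (hT.le.trans ht)]
    ring
  · simp [hg T hT]

lemma abs_fwdDiff_moment_le {k : ℕ} {ε : ℝ} (h0 : |α 0| ≤ 1)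
    (hε : ∀ t, 1 ≤ t → t ≤ 2 * k → |α t| ≤ ε) (hε0 : 0 ≤ ε) :
    (fwdDiff 1)^[k] (fun s => α (k + k - 2 * s)) 0 ≤ 1 + 2 ^ k * ε := by
  rw [fwdDiff_iter_eq_sum_shift]
  calc _ ≤ ∑ j ∈ Finset.range (k + 1), ((if j = k then 1 else 0) + (k.choose j : ℝ) * ε) := by
        refine Finset.sum_le_sum fun j hj => le_of_abs_le ?_
        rw [Finset.mem_range] at hj
        simp only [zero_add, smul_eq_mul, mul_one, zsmul_eq_mul]
        push_cast
        rw [abs_mul, abs_mul, abs_pow, abs_neg, abs_one, one_pow, one_mul, Nat.abs_cast]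
        split_ifs with hjk
        · subst hjk
          have : j + j - 2 * j = 0 := by omega
          rw [this, Nat.choose_self]
          push_cast
          linarith
        · rw [zero_add]
          gcongr
          exact hε _ (by omega) (by omega)
    _ = _ := by
        rw [Finset.sum_add_distrib, ← Finset.sum_mul]
        congr 1
        · simp
        · congr 1
          exact_mod_cast Nat.sum_range_choose k

lemma sum_mul_evalML_raising (hw : IsBalancedWeight w α) (g : Finset (Fin n) → ℝ)
    {σ : Fin n → Bool} (hσ : w σ ≠ 0) :
    evalML (raising g) (signs σ) = -evalML (lowering g) (signs σ) := by
  have h : evalML g (signs σ) * ∑ i, signs σ i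
      = evalML (raising g) (signs σ) + evalML (lowering g) (signs σ) := by
    simp_rw [evalML_signs, ← Finset.sum_add_distrib, ← add_mul, raising_add_lowering,
      Finset.sum_mul_sum, Finset.sum_mul]
    rw [Finset.sum_comm]
    conv_rhs => rw [Finset.sum_comm]
    refine Finset.sum_congr rfl fun i _ => ?_
    rw [← sum_symmDiff_right {i}]
    refine Finset.sum_congr rfl fun S _ => ?_
    rw [cubeChar_symmDiff, cubeChar_singleton, mul_assoc, mul_assoc, signs_mul_self, mul_one]
  rw [hw.balanced σ hσ, mul_zero] at h
  linarith

/-- On the balanced slice, the second moment of a homogeneous polynomial of small degree is at most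
`3 / 2` times its squared norm. -/
lemma sum_mul_evalML_sq_le_of_level (hw : IsBalancedWeight w α) {K : ℕ} (hK : 2 * K ≤ n)
    (hε : ∀ t, 1 ≤ t → t ≤ 2 * K → |α t| ≤ (2 * 2 ^ K)⁻¹) (k : ℕ) (hk : k ≤ K)
    (f : Finset (Fin n) → ℝ) (hf : ∀ S, #S ≠ k → f S = 0) :
    ∑ σ, w σ * evalML f (signs σ) ^ 2 ≤ 3 / 2 * ∑ S, f S ^ 2 := by
  induction k using Nat.strong_induction_on generalizing f with
  | _ k ih =>
    obtain ⟨h, g, hh, hg, hl, hfS, hsum⟩ := exists_harmonic_add_raising hf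
    have hharm : ∑ σ, w σ * (evalML h (signs σ) * evalML h (signs σ)) ≤ 3 / 2 * ∑ S, h S ^ 2 := by
      rw [hw.sum_harmonic_mul_evalML hh hl le_rfl hh]
      simp_rw [← sq]
      refine mul_le_mul_of_nonneg_right ?_ (Finset.sum_nonneg fun _ _ => sq_nonneg _)
      refine (abs_fwdDiff_moment_le (hw.abs_moment_le_one (Nat.zero_le n))
        (fun t h1 h2 => hε t h1 (by omega)) (by positivity)).trans ?_
      have h2 : (2 : ℝ) ^ k ≤ 2 ^ K := pow_le_pow_right₀ (by norm_num) hk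
      have h3 : (2 : ℝ) ^ k * (2 * 2 ^ K)⁻¹ ≤ 1 / 2 := by
        rw [← div_eq_mul_inv, div_le_div_iff₀ (by positivity) (by norm_num)]
        linarith
      linarith
    have hcross_low : ∑ σ, w σ * (evalML h (signs σ) * evalML (lowering g) (signs σ)) = 0 ∧
        ∑ σ, w σ * evalML (lowering g) (signs σ) ^ 2 ≤ 3 / 2 * ∑ S, raising g S ^ 2 := by
      have hlow : ∀ S, #S + 2 ≠ k → lowering g S = 0 := fun S hS =>
        Finset.sum_eq_zero fun i hi => hg _ (by
          rw [card_symmDiff_singleton_of_notMem (Finset.mem_compl.1 hi)]; exact hS)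
      by_cases hk2 : 2 ≤ k
      · have hlow' : ∀ S : Finset (Fin n), #S ≠ k - 2 → lowering g S = 0 := fun S hS =>
          hlow S (by omega)
        constructor
        · rw [hw.sum_harmonic_mul_evalML hh hl (Nat.sub_le k 2) hlow', Finset.sum_eq_zero, mul_zero]
          intro S _
          by_cases hS : #S = k
          · rw [hlow' S (by omega), mul_zero]
          · rw [hh S hS, zero_mul]
        · refine (ih (k - 2) (by omega) (by omega) _ hlow').trans ?_
          have := sum_lowering_sq_le (k := k - 1) (by omega) (f := g)
            fun S hS => hg S (by omega)
          linarith
      · have hz : ∀ σ, evalML (lowering g) (signs σ) = 0 := fun σ => by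
          rw [evalML_signs]
          exact Finset.sum_eq_zero fun S _ => by rw [hlow S (by omega), zero_mul]
        simp only [hz]
        constructor
        · simp
        · simp only [ne_eq, OfNat.ofNat_ne_zero, not_false_eq_true, zero_pow, mul_zero,
            Finset.sum_const_zero]
          positivity
    have hexp : ∑ σ, w σ * evalML f (signs σ) ^ 2
        = ∑ σ, w σ * (evalML h (signs σ) * evalML h (signs σ))
          - 2 * ∑ σ, w σ * (evalML h (signs σ) * evalML (lowering g) (signs σ))
          + ∑ σ, w σ * evalML (lowering g) (signs σ) ^ 2 := by
      rw [Finset.mul_sum, ← Finset.sum_sub_distrib, ← Finset.sum_add_distrib]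
      refine Finset.sum_congr rfl fun σ _ => ?_
      by_cases hσ : w σ = 0
      · simp [hσ]
      · have : evalML f (signs σ) = evalML h (signs σ) + evalML (raising g) (signs σ) := by
          simp_rw [evalML_signs, hfS, add_mul, Finset.sum_add_distrib]
        rw [this, hw.sum_mul_evalML_raising g hσ]
        ring
    rw [hexp, hcross_low.1, hsum]
    linarith [hcross_low.2]

lemma sum_mul_evalML_sq_le_of_levels (hw : IsBalancedWeight w α) {K : ℕ} (hK : 2 * K ≤ n)
    (hε : ∀ t, 1 ≤ t → t ≤ 2 * K → |α t| ≤ (2 * 2 ^ K)⁻¹) (J : Finset ℕ)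
    (hJ : ∀ k ∈ J, k ≤ K) (f : Finset (Fin n) → ℝ) (hf : ∀ S, #S ∉ J → f S = 0) :
    ∑ σ, w σ * evalML f (signs σ) ^ 2 ≤ #J * (3 / 2 * ∑ S, f S ^ 2) := by
  have hsplit : ∀ S, f S = ∑ k ∈ J, if #S = k then f S else 0 := fun S => by
    rw [Finset.sum_ite_eq]
    split_ifs with h
    · rfl
    · exact hf S h
  have hsq : ∀ S, f S ^ 2 = ∑ k ∈ J, (if #S = k then f S else 0) ^ 2 := fun S => by
    simp_rw [ite_pow]
    rw [zero_pow two_ne_zero, Finset.sum_ite_eq]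
    split_ifs with h
    · rfl
    · rw [hf S h]; ring
  have heval : ∀ σ, evalML f (signs σ)
      = ∑ k ∈ J, evalML (fun S => if #S = k then f S else 0) (signs σ) := fun σ => by
    simp_rw [evalML_signs]
    rw [Finset.sum_comm]
    exact Finset.sum_congr rfl fun S _ => by rw [← Finset.sum_mul, ← hsplit]
  calc _ ≤ ∑ σ, w σ * (#J * ∑ k ∈ J,
        evalML (fun S => if #S = k then f S else 0) (signs σ) ^ 2) := by
        refine Finset.sum_le_sum fun σ _ => mul_le_mul_of_nonneg_left ?_ (hw.nonneg σ)
        rw [heval]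
        exact sq_sum_le_card_mul_sum_sq
    _ = #J * ∑ k ∈ J, ∑ σ, w σ * evalML (fun S => if #S = k then f S else 0) (signs σ) ^ 2 := by
        rw [Finset.sum_comm, Finset.mul_sum]
        refine Finset.sum_congr rfl fun σ _ => ?_
        rw [← Finset.mul_sum]; ring
    _ ≤ #J * ∑ k ∈ J, 3 / 2 * ∑ S : Finset (Fin n), (if #S = k then f S else 0) ^ 2 := by
        refine mul_le_mul_of_nonneg_left (Finset.sum_le_sum fun k hk => ?_) (Nat.cast_nonneg _)
        exact hw.sum_mul_evalML_sq_le_of_level hK hε k (hJ k hk) _ fun S hS => if_neg hS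
    _ = _ := by
        rw [← Finset.mul_sum, Finset.sum_comm]
        rw [Finset.sum_congr rfl fun S _ => (hsq S).symm]

/-- On the balanced slice, the second moment of a polynomial of degree at most `2 * d` is at most
`3 * d` times its squared norm. -/
lemma sum_mul_evalML_sq_le (hw : IsBalancedWeight w α) {d : ℕ} (hd : 1 ≤ d) (hn : 4 * d < n)
    (hε : ∀ t, 1 ≤ t → t ≤ 4 * d → |α t| ≤ (2 * 2 ^ (2 * d))⁻¹) (f : Finset (Fin n) → ℝ)
    (hf : ∀ S, 2 * d < #S → f S = 0) :
    ∑ σ, w σ * evalML f (signs σ) ^ 2 ≤ 3 * d * ∑ S, f S ^ 2 := by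
  set fe : Finset (Fin n) → ℝ := fun S => if Even #S then f S else 0 with hfe
  set fo : Finset (Fin n) → ℝ := fun S => if Even #S then 0 else f S with hfo
  have hK : 2 * (2 * d) ≤ n := by omega
  have hε' : ∀ t, 1 ≤ t → t ≤ 2 * (2 * d) → |α t| ≤ (2 * 2 ^ (2 * d))⁻¹ := fun t h1 h2 =>
    hε t h1 (by omega)
  have he := hw.sum_mul_evalML_sq_le_of_levels hK hε' ((Finset.range (d + 1)).image (2 * ·))
    (fun k hk => by
      obtain ⟨j, hj, rfl⟩ := Finset.mem_image.1 hk
      rw [Finset.mem_range] at hj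
      omega) fe (fun S hS => by
      simp only [hfe]
      split_ifs with h
      · refine hf S (not_le.1 fun hle => hS ?_)
        obtain ⟨r, hr⟩ := h
        simp only [Finset.mem_image, Finset.mem_range]
        exact ⟨r, by omega, by omega⟩
      · rfl)
  have ho := hw.sum_mul_evalML_sq_le_of_levels hK hε' ((Finset.range d).image (2 * · + 1))
    (fun k hk => by
      obtain ⟨j, hj, rfl⟩ := Finset.mem_image.1 hk
      rw [Finset.mem_range] at hj
      omega) fo (fun S hS => by
      simp only [hfo]
      split_ifs with h
      · rfl
      · refine hf S (not_le.1 fun hle => hS ?_)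
        obtain ⟨r, hr⟩ := Nat.not_even_iff_odd.1 h
        simp only [Finset.mem_image, Finset.mem_range]
        exact ⟨r, by omega, by omega⟩)
  have hce : (#((Finset.range (d + 1)).image (2 * ·)) : ℝ) ≤ d + 1 := by
    exact_mod_cast Finset.card_image_le.trans_eq (Finset.card_range _)
  have hco : (#((Finset.range d).image (2 * · + 1)) : ℝ) ≤ d + 1 := by
    exact_mod_cast (Finset.card_image_le.trans_eq (Finset.card_range _)).trans (Nat.le_succ d)
  have hcross : ∑ σ, w σ * (evalML fe (signs σ) * evalML fo (signs σ)) = 0 := by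
    rw [hw.sum_mul_evalML_mul]
    refine Finset.sum_eq_zero fun T _ => ?_
    rw [Finset.mul_sum]
    refine Finset.sum_eq_zero fun S _ => ?_
    simp only [hfe, hfo]
    by_cases hT : Even #T
    · simp [hT]
    by_cases hS : Even #S
    · have hcard := card_symmDiff_add_two_mul_card_inter S T
      obtain ⟨r, hr⟩ := hS
      obtain ⟨s, hs⟩ := Nat.not_even_iff_odd.1 hT
      have hle : #(symmDiff S T) ≤ n := (Finset.card_le_univ _).trans_eq (Fintype.card_fin n)
      have hodd : #(symmDiff S T) = 2 * (r + s - #(S ∩ T)) + 1 := by omega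
      rw [hodd, hw.moment_odd _ (by omega)]
      ring
    · simp [hS]
  have hf_split : ∀ S, f S ^ 2 = fe S ^ 2 + fo S ^ 2 := fun S => by
    simp only [hfe, hfo]; split_ifs <;> ring
  have heval : ∀ σ, evalML f (signs σ) = evalML fe (signs σ) + evalML fo (signs σ) := fun σ => by
    simp_rw [evalML_signs, ← Finset.sum_add_distrib, ← add_mul]
    refine Finset.sum_congr rfl fun S _ => ?_
    simp only [hfe, hfo]; split_ifs <;> ring
  have hexp : ∑ σ, w σ * evalML f (signs σ) ^ 2 = ∑ σ, w σ * evalML fe (signs σ) ^ 2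
      + 2 * ∑ σ, w σ * (evalML fe (signs σ) * evalML fo (signs σ))
      + ∑ σ, w σ * evalML fo (signs σ) ^ 2 := by
    rw [Finset.mul_sum, ← Finset.sum_add_distrib, ← Finset.sum_add_distrib]
    exact Finset.sum_congr rfl fun σ _ => by rw [heval]; ring
  have hE : 0 ≤ ∑ S, fe S ^ 2 := Finset.sum_nonneg fun _ _ => sq_nonneg _
  have hO : 0 ≤ ∑ S, fo S ^ 2 := Finset.sum_nonneg fun _ _ => sq_nonneg _
  have hd' : (1 : ℝ) ≤ d := by exact_mod_cast hd
  rw [hexp, hcross]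
  simp_rw [hf_split, Finset.sum_add_distrib]
  nlinarith

end IsBalancedWeight

/-- The average over perfect matchings `M` of the distributions `P(M)`, as a weight on the cube. -/
noncomputable def matchingWeight {n : ℕ} (σ : Fin n → Bool) : ℝ :=
  (∑ m ∈ matchSet n, if σ ∈ pmSet m then ((#(pmSet m) : ℝ))⁻¹ else 0) / #(matchSet n)

lemma sum_matchingWeight_mul {n : ℕ} (F : (Fin n → Bool) → ℝ) :
    ∑ σ, matchingWeight σ * F σ = (∑ m ∈ matchSet n, expOver (pmSet m) F) / #(matchSet n) := by
  simp_rw [matchingWeight, div_mul_eq_mul_div, ← Finset.sum_div, Finset.sum_mul]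
  rw [Finset.sum_comm]
  congr 1
  refine Finset.sum_congr rfl fun m _ => ?_
  simp_rw [ite_mul, zero_mul]
  rw [Finset.sum_ite_mem, Finset.univ_inter, expOver, Finset.sum_div]
  exact Finset.sum_congr rfl fun σ _ => by rw [inv_mul_eq_div]

lemma expOver_sq_le {n : ℕ} (A : Finset (Fin n → Bool)) (F : (Fin n → Bool) → ℝ) :
    expOver A F ^ 2 ≤ expOver A (fun σ => F σ ^ 2) := by
  unfold expOver
  rcases A.eq_empty_or_nonempty with rfl | hA
  · simp
  · have hpos : (0 : ℝ) < #A := by exact_mod_cast hA.card_pos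
    rw [div_pow, div_le_div_iff₀ (by positivity) hpos]
    have := mul_le_mul_of_nonneg_right
      (sq_sum_le_card_mul_sum_sq (s := A) (f := F)) hpos.le
    linarith

lemma sum_signs_eq_zero_of_mem_pmSet {n : ℕ} {m : Fin n → Fin n} (hm : m ∈ matchSet n)
    {σ : Fin n → Bool} (hσ : σ ∈ pmSet m) : ∑ i, signs σ i = 0 := by
  simp only [matchSet, pmSet, Finset.mem_filter, Finset.mem_univ, true_and] at hm hσ
  have h : ∑ i, signs σ (m i) = ∑ i, signs σ i :=
    Equiv.sum_comp (Function.Involutive.toPerm m hm.1) (signs σ)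
  have h2 : ∀ i, signs σ (m i) = -signs σ i := fun i => by
    unfold signs; rw [hσ]; cases σ i <;> simp
  simp only [h2, Finset.sum_neg_distrib] at h
  linarith

/-- Conjugation of self-maps of `Fin n` by a permutation. -/
def conjMap {n : ℕ} (π : Equiv.Perm (Fin n)) : (Fin n → Fin n) ≃ (Fin n → Fin n) :=
  Equiv.arrowCongr π π

lemma conjMap_apply {n : ℕ} (π : Equiv.Perm (Fin n)) (m : Fin n → Fin n) (i : Fin n) :
    conjMap π m i = π (m (π.symm i)) := rfl

lemma conjMap_mem_matchSet {n : ℕ} (π : Equiv.Perm (Fin n)) (m : Fin n → Fin n) :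
    conjMap π m ∈ matchSet n ↔ m ∈ matchSet n := by
  simp only [matchSet, Finset.mem_filter, Finset.mem_univ, true_and, conjMap_apply]
  rw [π.surjective.forall, π.surjective.forall (p := fun i => π (m (π.symm i)) ≠ i)]
  simp

lemma mem_pmSet_conjMap {n : ℕ} (π : Equiv.Perm (Fin n)) (m : Fin n → Fin n)
    (σ : Fin n → Bool) : σ ∈ pmSet (conjMap π m) ↔ σ ∘ π ∈ pmSet m := by
  simp only [pmSet, Finset.mem_filter, Finset.mem_univ, true_and]
  rw [π.surjective.forall]
  simp [conjMap_apply]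

lemma card_pmSet_conjMap {n : ℕ} (π : Equiv.Perm (Fin n)) (m : Fin n → Fin n) :
    #(pmSet (conjMap π m)) = #(pmSet m) :=
  Finset.card_equiv (Equiv.arrowCongr π.symm (Equiv.refl Bool)) fun σ => mem_pmSet_conjMap π m σ

lemma matchingWeight_comp {n : ℕ} (π : Equiv.Perm (Fin n)) (σ : Fin n → Bool) :
    matchingWeight (σ ∘ π) = matchingWeight σ := by
  unfold matchingWeight
  congr 1
  refine Finset.sum_equiv (conjMap π) (fun m => (conjMap_mem_matchSet π m).symm) fun m _ => ?_
  simp only [mem_pmSet_conjMap, card_pmSet_conjMap]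

lemma cubeChar_comp {n : ℕ} (π : Equiv.Perm (Fin n)) (S : Finset (Fin n)) (σ : Fin n → Bool) :
    cubeChar S (σ ∘ π) = cubeChar (S.map π.toEmbedding) σ := by
  simp [cubeChar, signs]

lemma exists_isBalancedWeight_matchingWeight (n : ℕ) :
    ∃ α : ℕ → ℝ, IsBalancedWeight (matchingWeight (n := n)) α := by
  have hfac : Function.FactorsThrough
      (fun S : Finset (Fin n) => ∑ σ, matchingWeight σ * cubeChar S σ) Finset.card := by
    intro S T hST
    have e : {x // x ∈ S} ≃ {x // x ∈ T} := Finset.equivOfCardEq hST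
    have hT : S.map e.extendSubtype.toEmbedding = T := by
      refine Finset.eq_of_subset_of_card_le ?_ (by rw [Finset.card_map, hST])
      intro y hy
      obtain ⟨x, hx, rfl⟩ := Finset.mem_map.1 hy
      exact e.extendSubtype_mem x hx
    have h := Equiv.sum_comp (Equiv.arrowCongr e.extendSubtype.symm (Equiv.refl Bool))
      fun σ => matchingWeight σ * cubeChar S σ
    change ∑ σ : Fin n → Bool, matchingWeight (σ ∘ e.extendSubtype) *
      cubeChar S (σ ∘ e.extendSubtype) = _ at h
    simp only [matchingWeight_comp, cubeChar_comp, hT] at h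
    exact h.symm
  refine ⟨Function.extend Finset.card
    (fun S : Finset (Fin n) => ∑ σ, matchingWeight σ * cubeChar S σ) 0, ?_, ?_, ?_, ?_⟩
  · intro σ
    refine div_nonneg (Finset.sum_nonneg fun m _ => ?_) (Nat.cast_nonneg _)
    split_ifs <;> positivity
  · have h := sum_matchingWeight_mul (n := n) fun _ => 1
    simp only [mul_one] at h
    rw [h]
    refine div_le_one_of_le₀ ?_ (Nat.cast_nonneg _)
    rw [Finset.card_eq_sum_ones, Nat.cast_sum]
    refine Finset.sum_le_sum fun m _ => ?_
    simp only [expOver, Finset.sum_const, nsmul_eq_mul, mul_one, Nat.cast_one]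
    exact div_self_le_one _
  · intro σ hσ
    by_contra hne
    refine hσ ?_
    rw [matchingWeight, Finset.sum_eq_zero, zero_div]
    exact fun m hm => if_neg fun h => hne (sum_signs_eq_zero_of_mem_pmSet hm h)
  · exact fun S => (hfac.extend_apply 0 S).symm

theorem stmt8 (d : ℕ) (hd : 1 ≤ d) :
    ∃ n₀ : ℕ, ∀ n : ℕ, n₀ ≤ n → Even n →
      ∀ c : Finset (Fin n) → ℝ, (∀ S, d < S.card → c S = 0) →
        (∑ m ∈ matchSet n, (expOver (pmSet m) (fun σ => (evalML c (signs σ)) ^ 2)) ^ 2) /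
            (matchSet n).card ≤
          3 * (d : ℝ) * 9 ^ d * (∑ S : Finset (Fin n), c S ^ 2) ^ 2 := by
  refine ⟨4 * d + 4 * d * (2 * 2 ^ (2 * d)) + 1, fun n hn _ c hc => ?_⟩
  obtain ⟨α, hw⟩ := exists_isBalancedWeight_matchingWeight n
  have hdn : 4 * d < n := by
    have := Nat.zero_le (4 * d * (2 * 2 ^ (2 * d)))
    omega
  have hε : ∀ t, 1 ≤ t → t ≤ 4 * d → |α t| ≤ (2 * 2 ^ (2 * d))⁻¹ := by
    intro t h1 h2
    refine (hw.abs_moment_le h1 h2 hdn).trans ?_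
    have hn' : ((4 * d : ℕ) : ℝ) + (4 * d : ℕ) * (2 * 2 ^ (2 * d)) + 1 ≤ n := by
      exact_mod_cast hn
    have hdn' : ((4 * d : ℕ) : ℝ) < n := by exact_mod_cast hdn
    rw [inv_eq_one_div, div_le_div_iff₀ (by linarith) (by positivity)]
    linarith
  calc _ ≤ (∑ m ∈ matchSet n, expOver (pmSet m) fun σ => (evalML c (signs σ) ^ 2) ^ 2) /
        #(matchSet n) := by
        gcongr
        exact expOver_sq_le _ _
    _ = ∑ σ, matchingWeight σ * evalML (sqCoeff c) (signs σ) ^ 2 := by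
        simp_rw [evalML_sqCoeff]
        rw [sum_matchingWeight_mul]
    _ ≤ 3 * d * ∑ U, sqCoeff c U ^ 2 :=
        hw.sum_mul_evalML_sq_le hd hdn hε _ fun U hU => sqCoeff_eq_zero hc hU
    _ ≤ 3 * d * (9 ^ d * (∑ S, c S ^ 2) ^ 2) := by
        gcongr
        exact sum_sqCoeff_sq_le hc
    _ = _ := by ring
end

section
/- Let n be even and let M be any perfect matching of [n]. Then for every multilinear polynomial g of degree at most d on n variables, E_{P(M)}[g⁴] ≤ 9^d · (E_{P(M)}[g²])². Consequently, averaging over a uniformly random perfect matching M of [n], E_M[E_{P(M)}[g⁴]] ≤ 9^d · E_M[(E_{P(M)}[g²])²]. -/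
open Finset

/-- The average of the two restrictions of `f` obtained by fixing the first bit. -/
noncomputable def evenPart {n : ℕ} (f : (Fin (n + 1) → Bool) → ℝ) (y : Fin n → Bool) : ℝ :=
  (f (Fin.cons true y) + f (Fin.cons false y)) / 2

/-- Half the difference of the two restrictions of `f` obtained by fixing the first bit. -/
noncomputable def oddPart {n : ℕ} (f : (Fin (n + 1) → Bool) → ℝ) (y : Fin n → Bool) : ℝ :=
  (f (Fin.cons true y) - f (Fin.cons false y)) / 2

/-- `f` is a function on the Boolean cube of Fourier degree at most `d`. -/
def CubeDegreeLE : (n d : ℕ) → ((Fin n → Bool) → ℝ) → Prop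
  | 0, _, _ => True
  | n + 1, 0, f => CubeDegreeLE n 0 (evenPart f) ∧ oddPart f = 0
  | n + 1, d + 1, f => CubeDegreeLE n (d + 1) (evenPart f) ∧ CubeDegreeLE n d (oddPart f)

namespace CubeDegreeLE

theorem const {n : ℕ} (d : ℕ) (a : ℝ) : CubeDegreeLE n d (fun _ => a) := by
  induction n generalizing d a with
  | zero => simp [CubeDegreeLE]
  | succ n ih =>
    have he : evenPart (fun _ : Fin (n + 1) → Bool => a) = fun _ => a := by
      funext y; simp [evenPart]
    have ho : oddPart (fun _ : Fin (n + 1) → Bool => a) = fun _ => 0 := by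
      funext y; simp [oddPart]
    cases d with
    | zero => exact ⟨he ▸ ih 0 a, ho⟩
    | succ d => exact ⟨he ▸ ih (d + 1) a, ho ▸ ih d 0⟩

theorem add {n d : ℕ} {f g : (Fin n → Bool) → ℝ} (hf : CubeDegreeLE n d f)
    (hg : CubeDegreeLE n d g) : CubeDegreeLE n d (fun y => f y + g y) := by
  induction n generalizing d with
  | zero => simp [CubeDegreeLE]
  | succ n ih =>
    have he : evenPart (fun y => f y + g y) = fun y => evenPart f y + evenPart g y := by
      funext y; simp only [evenPart]; ring
    have ho : oddPart (fun y => f y + g y) = fun y => oddPart f y + oddPart g y := by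
      funext y; simp only [oddPart]; ring
    cases d with
    | zero =>
      refine ⟨he ▸ ih hf.1 hg.1, ?_⟩
      rw [ho, hf.2, hg.2]
      funext y; simp
    | succ d => exact ⟨he ▸ ih hf.1 hg.1, ho ▸ ih hf.2 hg.2⟩

theorem const_mul {n d : ℕ} {f : (Fin n → Bool) → ℝ} (a : ℝ) (hf : CubeDegreeLE n d f) :
    CubeDegreeLE n d (fun y => a * f y) := by
  induction n generalizing d with
  | zero => simp [CubeDegreeLE]
  | succ n ih =>
    have he : evenPart (fun y => a * f y) = fun y => a * evenPart f y := by
      funext y; simp only [evenPart]; ring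
    have ho : oddPart (fun y => a * f y) = fun y => a * oddPart f y := by
      funext y; simp only [oddPart]; ring
    cases d with
    | zero =>
      refine ⟨he ▸ ih hf.1, ?_⟩
      rw [ho, hf.2]
      funext y; simp
    | succ d => exact ⟨he ▸ ih hf.1, ho ▸ ih hf.2⟩

theorem sum {n d : ℕ} {ι : Type*} (s : Finset ι) {f : ι → (Fin n → Bool) → ℝ}
    (hf : ∀ i ∈ s, CubeDegreeLE n d (f i)) : CubeDegreeLE n d (fun y => ∑ i ∈ s, f i y) := by
  classical
  induction s using Finset.induction_on with
  | empty => simpa using const d 0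
  | insert i s hi ih =>
    simp only [Finset.sum_insert hi]
    exact (hf i (by simp)).add (ih fun j hj => hf j (by simp [hj]))

theorem succ {n d : ℕ} {f : (Fin n → Bool) → ℝ} (hf : CubeDegreeLE n d f) :
    CubeDegreeLE n (d + 1) f := by
  induction n generalizing d with
  | zero => simp [CubeDegreeLE]
  | succ n ih =>
    cases d with
    | zero => exact ⟨ih hf.1, hf.2 ▸ const 0 0⟩
    | succ d => exact ⟨ih hf.1, ih hf.2⟩

theorem mono {n d e : ℕ} {f : (Fin n → Bool) → ℝ} (hde : d ≤ e) (hf : CubeDegreeLE n d f) :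
    CubeDegreeLE n e f := by
  induction e, hde using Nat.le_induction with
  | base => exact hf
  | succ e _ ih => exact ih.succ

theorem signs_mul {n d : ℕ} {f : (Fin n → Bool) → ℝ} (j : Fin n) (hf : CubeDegreeLE n d f) :
    CubeDegreeLE n (d + 1) (fun y => signs y j * f y) := by
  induction n generalizing d with
  | zero => exact j.elim0
  | succ n ih =>
    cases j using Fin.cases with
    | zero =>
      have he : evenPart (fun y => signs y 0 * f y) = oddPart f := by
        funext y; simp only [evenPart, oddPart, signs, Fin.cons_zero]; norm_num; ring
      have ho : oddPart (fun y => signs y 0 * f y) = evenPart f := by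
        funext y; simp only [evenPart, oddPart, signs, Fin.cons_zero]; norm_num
      cases d with
      | zero => exact ⟨he ▸ hf.2 ▸ const 1 0, ho ▸ hf.1⟩
      | succ d => exact ⟨he ▸ hf.2.succ.succ, ho ▸ hf.1⟩
    | succ j =>
      have he : evenPart (fun y => signs y j.succ * f y) = fun y => signs y j * evenPart f y := by
        funext y; simp only [evenPart, signs, Fin.cons_succ]; ring
      have ho : oddPart (fun y => signs y j.succ * f y) = fun y => signs y j * oddPart f y := by
        funext y; simp only [oddPart, signs, Fin.cons_succ]; ring
      cases d with
      | zero =>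
        refine ⟨he ▸ ih j hf.1, ?_⟩
        rw [ho, hf.2]
        simpa using const (n := n) 0 0
      | succ d => exact ⟨he ▸ ih j hf.1, ho ▸ ih j hf.2⟩

end CubeDegreeLE

theorem sum_cube_succ {n : ℕ} (F : (Fin (n + 1) → Bool) → ℝ) :
    ∑ y, F y = ∑ y : Fin n → Bool, (F (Fin.cons true y) + F (Fin.cons false y)) := by
  rw [← (Fin.consEquiv fun _ : Fin (n + 1) => Bool).sum_comp, Fintype.sum_prod_type_right]
  simp [Fin.consEquiv]

/-- The two-function inequality behind the induction step of Bonami's lemma. -/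
theorem sum_fourth_power_step {α : Type*} [Fintype α] {N K : ℝ} (hN : 0 ≤ N) (hK : 0 ≤ K)
    (g h : α → ℝ) (hg : N * ∑ y, g y ^ 4 ≤ 9 * K * (∑ y, g y ^ 2) ^ 2)
    (hh : N * ∑ y, h y ^ 4 ≤ K * (∑ y, h y ^ 2) ^ 2) :
    N * ∑ y, (g y ^ 4 + 6 * (g y ^ 2 * h y ^ 2) + h y ^ 4) ≤
      9 * K * (∑ y, g y ^ 2 + ∑ y, h y ^ 2) ^ 2 := by
  have hA : 0 ≤ ∑ y, g y ^ 2 := Finset.sum_nonneg fun y _ => sq_nonneg _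
  have hB : 0 ≤ ∑ y, h y ^ 2 := Finset.sum_nonneg fun y _ => sq_nonneg _
  have hC : 0 ≤ ∑ y, g y ^ 2 * h y ^ 2 := Finset.sum_nonneg fun y _ => by positivity
  have hD : 0 ≤ ∑ y, h y ^ 4 := Finset.sum_nonneg fun y _ => by positivity
  have cs : (∑ y, g y ^ 2 * h y ^ 2) ^ 2 ≤ (∑ y, g y ^ 4) * ∑ y, h y ^ 4 := by
    have := Finset.sum_mul_sq_le_sq_mul_sq Finset.univ (fun y => g y ^ 2) (fun y => h y ^ 2)
    simpa only [← pow_mul] using this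
  rw [Finset.sum_add_distrib, Finset.sum_add_distrib, ← Finset.mul_sum]
  set A := ∑ y, g y ^ 2
  set B := ∑ y, h y ^ 2
  set C := ∑ y, g y ^ 2 * h y ^ 2
  have hNC : N * C ≤ 3 * K * (A * B) := by
    refine le_of_sq_le_sq ?_ (by positivity)
    calc (N * C) ^ 2 = N ^ 2 * C ^ 2 := by ring
      _ ≤ N ^ 2 * ((∑ y, g y ^ 4) * ∑ y, h y ^ 4) := by gcongr
      _ = (N * ∑ y, g y ^ 4) * (N * ∑ y, h y ^ 4) := by ring
      _ ≤ (9 * K * A ^ 2) * (K * B ^ 2) := by gcongr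
      _ = (3 * K * (A * B)) ^ 2 := by ring
  have : 0 ≤ K * B ^ 2 := by positivity
  nlinarith

/-- **Bonami's lemma** on the Boolean cube, for fourth moments. -/
theorem CubeDegreeLE.sum_fourth_power_le {n d : ℕ} {f : (Fin n → Bool) → ℝ}
    (hf : CubeDegreeLE n d f) :
    2 ^ n * ∑ y, f y ^ 4 ≤ (9 : ℝ) ^ d * (∑ y, f y ^ 2) ^ 2 := by
  induction n generalizing d with
  | zero =>
    have h9 : (1 : ℝ) ≤ 9 ^ d := one_le_pow₀ (by norm_num)
    simp only [Fintype.sum_unique, pow_zero, ← pow_mul]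
    norm_num
    exact le_mul_of_one_le_left (by positivity) h9
  | succ n ih =>
    have h2 : ∑ y, f y ^ 2 = 2 * (∑ y, evenPart f y ^ 2 + ∑ y, oddPart f y ^ 2) := by
      rw [sum_cube_succ, ← Finset.sum_add_distrib, Finset.mul_sum]
      refine Finset.sum_congr rfl fun y _ => ?_
      simp only [evenPart, oddPart]; ring
    have h4 : ∑ y, f y ^ 4 = 2 * ∑ y, (evenPart f y ^ 4 +
        6 * (evenPart f y ^ 2 * oddPart f y ^ 2) + oddPart f y ^ 4) := by
      rw [sum_cube_succ, Finset.mul_sum]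
      refine Finset.sum_congr rfl fun y _ => ?_
      simp only [evenPart, oddPart]; ring
    rw [h2, h4]
    cases d with
    | zero =>
      have := ih hf.1
      simp only [hf.2, Pi.zero_apply]
      norm_num at this ⊢
      rw [pow_succ]
      nlinarith
    | succ d =>
      have hg := ih hf.1
      rw [pow_succ'] at hg ⊢
      have := sum_fourth_power_step (N := 2 ^ n) (by positivity) (by positivity) _ _ hg (ih hf.2)
      rw [pow_succ' (9 : ℝ) d]
      nlinarith

/-- The element of `pmSet m` whose values on the smaller elements of the pairs, enumerated
by `e`, are `y`. -/
def pmExtend {n k : ℕ} (m : Fin n → Fin n) (hm : ∀ i, m (m i) = i) (hm' : ∀ i, m i ≠ i)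
    (e : {i // i < m i} ≃ Fin k) (y : Fin k → Bool) : Fin n → Bool := fun i =>
  if h : i < m i then y (e ⟨i, h⟩)
  else !(y (e ⟨m i, by rw [hm]; exact lt_of_le_of_ne (not_lt.1 h) (hm' i)⟩))

section Matching

variable {n k : ℕ} {m : Fin n → Fin n} (hm : ∀ i, m (m i) = i) (hm' : ∀ i, m i ≠ i)
  (e : {i // i < m i} ≃ Fin k)

theorem pmExtend_mem_pmSet (y : Fin k → Bool) : pmExtend m hm hm' e y ∈ pmSet m := by
  simp only [pmSet, Finset.mem_filter, Finset.mem_univ, true_and]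
  intro i
  by_cases h : i < m i
  · simp [pmExtend, h, h.not_gt, hm]
  · have h' : m i < m (m i) := by rw [hm]; exact lt_of_le_of_ne (not_lt.1 h) (hm' i)
    simp [pmExtend, h, h']

theorem sum_pmSet (F : (Fin n → Bool) → ℝ) :
    ∑ σ ∈ pmSet m, F σ = ∑ y, F (pmExtend m hm hm' e y) := by
  symm
  refine Finset.sum_nbij' (pmExtend m hm hm' e) (fun σ j => σ (e.symm j).1)
    (fun y _ => pmExtend_mem_pmSet hm hm' e y) (fun _ _ => Finset.mem_univ _) ?_ ?_
    fun _ _ => rfl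
  · intro y _
    funext j
    simp [pmExtend, (e.symm j).2]
  · intro σ hσ
    simp only [pmSet, Finset.mem_filter, Finset.mem_univ, true_and] at hσ
    funext i
    by_cases h : i < m i <;> simp [pmExtend, h, hσ]

theorem signs_pmExtend (i : Fin n) :
    ∃ (a : ℝ) (j : Fin k), ∀ y, signs (pmExtend m hm hm' e y) i = a * signs y j := by
  by_cases h : i < m i
  · exact ⟨1, e ⟨i, h⟩, fun y => by simp [signs, pmExtend, h]⟩
  · refine ⟨-1, e ⟨m i, by rw [hm]; exact lt_of_le_of_ne (not_lt.1 h) (hm' i)⟩, fun y => ?_⟩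
    simp only [signs, pmExtend, h, dite_false]
    cases y (e ⟨m i, _⟩) <;> simp

theorem CubeDegreeLE.prod_signs_pmExtend (S : Finset (Fin n)) :
    CubeDegreeLE k S.card (fun y => ∏ i ∈ S, signs (pmExtend m hm hm' e y) i) := by
  induction S using Finset.induction_on with
  | empty => simpa using const 0 1
  | insert i S hi ih =>
    obtain ⟨a, j, h⟩ := signs_pmExtend hm hm' e i
    simp only [Finset.prod_insert hi, Finset.card_insert_of_notMem hi, h, mul_assoc]
    exact (ih.signs_mul j).const_mul a

theorem CubeDegreeLE.evalML_pmExtend {d : ℕ} {c : Finset (Fin n) → ℝ}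
    (hdeg : ∀ S, d < S.card → c S = 0) :
    CubeDegreeLE k d (fun y => evalML c (signs (pmExtend m hm hm' e y))) := by
  refine sum _ fun S _ => ?_
  by_cases hS : d < S.card
  · simpa [hdeg S hS] using const d 0
  · exact ((prod_signs_pmExtend hm hm' e S).mono (not_lt.1 hS)).const_mul _

end Matching

/-- Hypercontractivity for the distribution attached to a single perfect matching. -/
theorem expOver_pmSet_fourth_power_le {n d : ℕ} {c : Finset (Fin n) → ℝ}
    (hdeg : ∀ S, d < S.card → c S = 0) {m : Fin n → Fin n} (hm : ∀ i, m (m i) = i)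
    (hm' : ∀ i, m i ≠ i) :
    expOver (pmSet m) (fun σ => (evalML c (signs σ)) ^ 4) ≤
      (9 : ℝ) ^ d * (expOver (pmSet m) (fun σ => (evalML c (signs σ)) ^ 2)) ^ 2 := by
  have e := Fintype.equivFin {i // i < m i}
  have hcard : ((pmSet m).card : ℝ) = 2 ^ Fintype.card {i // i < m i} := by
    simpa using sum_pmSet hm hm' e fun _ => 1
  have h := (CubeDegreeLE.evalML_pmExtend hm hm' e hdeg).sum_fourth_power_le
  simp only [expOver, hcard, sum_pmSet hm hm' e]
  rw [div_pow, ← mul_div_assoc, div_le_div_iff₀ (by positivity) (by positivity)]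
  nlinarith [pow_pos (two_pos : (0 : ℝ) < 2) (Fintype.card {i // i < m i})]

theorem stmt9 (n : ℕ) (hn : Even n) (d : ℕ)
    (c : Finset (Fin n) → ℝ) (hdeg : ∀ S, d < S.card → c S = 0) :
    (∀ m : Fin n → Fin n, (∀ i, m (m i) = i) → (∀ i, m i ≠ i) →
      expOver (pmSet m) (fun σ => (evalML c (signs σ)) ^ 4) ≤
        (9 : ℝ) ^ d * (expOver (pmSet m) (fun σ => (evalML c (signs σ)) ^ 2)) ^ 2) ∧
    (∑ m ∈ matchSet n, expOver (pmSet m) (fun σ => (evalML c (signs σ)) ^ 4)) /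
        (matchSet n).card ≤
      (9 : ℝ) ^ d *
        ((∑ m ∈ matchSet n, (expOver (pmSet m) (fun σ => (evalML c (signs σ)) ^ 2)) ^ 2) /
          (matchSet n).card) := by
  have key := fun m : Fin n → Fin n =>
    expOver_pmSet_fourth_power_le (m := m) hdeg
  refine ⟨key, ?_⟩
  rw [← mul_div_assoc, Finset.mul_sum]
  gcongr with m hm
  simp only [matchSet, Finset.mem_filter, Finset.mem_univ, true_and] at hm
  exact key m hm.1 hm.2
end

section
/- For every integer d ≥ 1 and real γ > 0 there exists n₀ depending only on d and γ such that the following holds for all even n ≥ n₀. Let f be a multilinear polynomial of degree at most d on n variables all of whose coefficients f̂(S) are integer multiples of γ, and let h_f be a multilinear polynomial of degree at most d−1 minimizing ‖f − (Σ_{i=1}^n x_i)·h‖₂² over all multilinear polynomials h of degree at most d−1 (here f − (Σ_i x_i)·h is expanded as a multilinear polynomial and ‖·‖₂² is the sum of its squared coefficients). Suppose ‖f − (Σ_i x_i)·h_f‖₂² ≤ √n. Then there exists a multilinear polynomial h of degree at most d−1 all of whose coefficients are integer multiples of γ/(d!·(d−1)!·⋯·2!) such that ‖f − (Σ_i x_i)·h‖₂²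 ≤ 7^d · ‖f − (Σ_i x_i)·h_f‖₂². -/
open Finset

/-- Coefficient at `T` of the multilinear expansion of `(∑ i, x i) * h` (using `x i ^ 2 = 1`). -/
noncomputable def mulSum {n : ℕ} (h : Finset (Fin n) → ℝ) (T : Finset (Fin n)) : ℝ :=
  ∑ i : Fin n, h (symmDiff T {i})

/-- The part of `mulSum h` that raises the degree. -/
noncomputable def mulSumUp {n : ℕ} (h : Finset (Fin n) → ℝ) (T : Finset (Fin n)) : ℝ :=
  ∑ i : Fin n, if i ∈ T then h (symmDiff T {i}) else 0

/-- The part of `mulSum h` that lowers the degree. -/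
noncomputable def mulSumDown {n : ℕ} (h : Finset (Fin n) → ℝ) (T : Finset (Fin n)) : ℝ :=
  ∑ i : Fin n, if i ∈ T then 0 else h (symmDiff T {i})

section SymmDiff

variable {n : ℕ}

theorem mulSum_eq_up_add_down (h : Finset (Fin n) → ℝ) (T : Finset (Fin n)) :
    mulSum h T = mulSumUp h T + mulSumDown h T := by
  simp only [mulSum, mulSumUp, mulSumDown, ← Finset.sum_add_distrib]
  refine Finset.sum_congr rfl fun i _ => ?_
  split_ifs <;> simp

theorem mulSum_add (g h : Finset (Fin n) → ℝ) (T : Finset (Fin n)) :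
    mulSum (fun S => g S + h S) T = mulSum g T + mulSum h T := by
  simp [mulSum, Finset.sum_add_distrib]

theorem card_symmDiff_singleton_of_mem_s10 {T : Finset (Fin n)} {i : Fin n} (hi : i ∈ T) :
    (symmDiff T {i}).card + 1 = T.card := by
  have : symmDiff T {i} = T.erase i := by
    ext j; by_cases h : j = i <;> simp [Finset.mem_symmDiff, h, hi]
  rw [this, Finset.card_erase_add_one hi]

theorem card_symmDiff_singleton_of_notMem_s10 {T : Finset (Fin n)} {i : Fin n} (hi : i ∉ T) :
    (symmDiff T {i}).card = T.card + 1 := by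
  have : symmDiff T {i} = insert i T := by
    ext j; by_cases h : j = i <;> simp [Finset.mem_symmDiff, h, hi]
  rw [this, Finset.card_insert_of_notMem hi]

theorem mulSumUp_eq_zero {d : ℕ} {h : Finset (Fin n) → ℝ} (hh : ∀ S, S.card ≠ d → h S = 0)
    {T : Finset (Fin n)} (hT : T.card ≠ d + 1) : mulSumUp h T = 0 := by
  refine Finset.sum_eq_zero fun i _ => ?_
  split_ifs with hi
  · exact hh _ (by have := card_symmDiff_singleton_of_mem_s10 hi; omega)
  · rfl

theorem mulSumDown_eq_zero {d : ℕ} {h : Finset (Fin n) → ℝ} (hh : ∀ S, d < S.card → h S = 0)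
    {T : Finset (Fin n)} (hT : d ≤ T.card) : mulSumDown h T = 0 := by
  refine Finset.sum_eq_zero fun i _ => ?_
  split_ifs with hi
  · rfl
  · exact hh _ (by have := card_symmDiff_singleton_of_notMem_s10 hi; omega)

theorem mulSum_eq_zero {d : ℕ} {h : Finset (Fin n) → ℝ} (hh : ∀ S, d ≤ S.card → h S = 0)
    {T : Finset (Fin n)} (hT : d < T.card) : mulSum h T = 0 := by
  refine Finset.sum_eq_zero fun i _ => hh _ ?_
  by_cases hi : i ∈ T
  · have := card_symmDiff_singleton_of_mem_s10 hi; omega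
  · have := card_symmDiff_singleton_of_notMem_s10 hi; omega

theorem sum_symmDiff_singleton (F : Finset (Fin n) → ℝ) (i : Fin n) :
    ∑ T, F (symmDiff T {i}) = ∑ T, F T :=
  Fintype.sum_equiv (Function.Involutive.toPerm (fun T => symmDiff T {i})
    fun _ => symmDiff_symmDiff_cancel_right _ _) _ _ fun _ => rfl

theorem sum_mul_mulSumUp (a u : Finset (Fin n) → ℝ) :
    ∑ T, a T * mulSumUp u T = ∑ S, u S * mulSumDown a S := by
  simp only [mulSumUp, mulSumDown, Finset.mul_sum]
  rw [Finset.sum_comm]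
  conv_rhs => rw [Finset.sum_comm]
  refine Finset.sum_congr rfl fun i _ => ?_
  rw [← sum_symmDiff_singleton _ i]
  refine Finset.sum_congr rfl fun T _ => ?_
  by_cases hi : i ∈ T <;> simp [Finset.mem_symmDiff, hi, mul_comm]

/-- The commutation relation between the two parts of multiplication by `∑ i, x i`. -/
theorem sum_mulSumUp_sq (u : Finset (Fin n) → ℝ) :
    ∑ T, mulSumUp u T ^ 2 = ∑ T, mulSumDown u T ^ 2 + ∑ T, ((n : ℝ) - 2 * T.card) * u T ^ 2 := by
  have key : ∀ i j : Fin n,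
      ∑ T : Finset (Fin n), (if i ∈ T then u (symmDiff T {i}) else 0) *
          (if j ∈ T then u (symmDiff T {j}) else 0) =
        ∑ T : Finset (Fin n), (if i ∈ T then 0 else u (symmDiff T {i})) *
          (if j ∈ T then 0 else u (symmDiff T {j})) +
        ∑ T : Finset (Fin n), if i = j then (1 - 2 * if i ∈ T then 1 else 0) * u T ^ 2 else 0 := by
    intro i j
    by_cases hij : i = j
    · subst hij
      rw [← sum_symmDiff_singleton _ i, ← sum_symmDiff_singleton (fun T =>
        (if i ∈ T then 0 else u (symmDiff T {i})) * (if i ∈ T then 0 else u (symmDiff T {i}))) i,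
        ← Finset.sum_add_distrib]
      refine Finset.sum_congr rfl fun T _ => ?_
      by_cases hi : i ∈ T <;> simp [Finset.mem_symmDiff, hi] <;> ring
    · simp only [hij, if_false, Finset.sum_const_zero, add_zero]
      rw [← sum_symmDiff_singleton _ i, ← sum_symmDiff_singleton _ j]
      refine Finset.sum_congr rfl fun T _ => ?_
      have hji : ¬ j = i := fun h => hij h.symm
      have h1 : symmDiff (symmDiff (symmDiff T {j}) {i}) {j} = symmDiff T {i} := by
        rw [symmDiff_right_comm, symmDiff_symmDiff_cancel_right]
      by_cases hi : i ∈ T <;> by_cases hj : j ∈ T <;>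
        simp [Finset.mem_symmDiff, hi, hj, hij, hji, h1, mul_comm]
  have expand : ∀ F : Fin n → Finset (Fin n) → ℝ,
      ∑ T, (∑ i, F i T) ^ 2 = ∑ i, ∑ j, ∑ T, F i T * F j T := by
    intro F
    simp only [sq, Finset.sum_mul_sum]
    rw [Finset.sum_comm]
    exact Finset.sum_congr rfl fun i _ => Finset.sum_comm
  simp only [mulSumUp, mulSumDown]
  rw [expand (fun i T => if i ∈ T then u (symmDiff T {i}) else 0),
    expand (fun i T => if i ∈ T then 0 else u (symmDiff T {i}))]
  simp only [key, Finset.sum_add_distrib]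
  congr 1
  have : ∀ i : Fin n, ∑ j : Fin n, ∑ T : Finset (Fin n),
      (if i = j then (1 - 2 * if i ∈ T then (1 : ℝ) else 0) * u T ^ 2 else 0) =
      ∑ T : Finset (Fin n), (1 - 2 * if i ∈ T then (1 : ℝ) else 0) * u T ^ 2 := by
    intro i
    rw [Finset.sum_comm]
    simp
  simp only [this]
  rw [Finset.sum_comm]
  refine Finset.sum_congr rfl fun T _ => ?_
  rw [← Finset.sum_mul, Finset.sum_sub_distrib, ← Finset.mul_sum]
  simp

theorem sum_mulSumDown_sq_le {d : ℕ} (hn : 2 * d ≤ n) {u : Finset (Fin n) → ℝ}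
    (hu : ∀ S, d < S.card → u S = 0) :
    ∑ T, mulSumDown u T ^ 2 ≤ ∑ T, mulSumUp u T ^ 2 := by
  rw [sum_mulSumUp_sq]
  refine le_add_of_nonneg_right (Finset.sum_nonneg fun T _ => ?_)
  by_cases hT : d < T.card
  · simp [hu T hT]
  · have : (2 * T.card : ℝ) ≤ n := by exact_mod_cast (by omega : 2 * T.card ≤ n)
    exact mul_nonneg (by linarith) (sq_nonneg _)

/-- The subsets of `S ∪ W` with `k` elements, `b` of which lie in `W`. -/
def crossSets (S W : Finset (Fin n)) (k b : ℕ) : Finset (Finset (Fin n)) :=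
  {T | T ⊆ S ∪ W ∧ T.card = k ∧ (T ∩ W).card = b}

theorem mulSumDown_crossSets {S W : Finset (Fin n)} (hSW : Disjoint S W) (k b : ℕ)
    (R : Finset (Fin n)) :
    mulSumDown (fun T => if T ∈ crossSets S W (k + 1) (b + 1) then (1 : ℝ) else 0) R =
      ((S.card : ℝ) - k + (b + 1)) * (if R ∈ crossSets S W k (b + 1) then 1 else 0) +
        ((W.card : ℝ) - b) * (if R ∈ crossSets S W k b then 1 else 0) := by
  have hmem : ∀ i, i ∉ R → ((symmDiff R {i} ∈ crossSets S W (k + 1) (b + 1)) ↔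
      (i ∈ S ∧ R ∈ crossSets S W k (b + 1)) ∨ (i ∈ W ∧ R ∈ crossSets S W k b)) := by
    intro i hi
    have : symmDiff R {i} = insert i R := by
      ext j; by_cases h : j = i <;> simp [Finset.mem_symmDiff, h, hi]
    rw [this]
    have hinter : i ∉ R ∩ W := fun h => hi (Finset.mem_inter.1 h).1
    simp only [crossSets, Finset.mem_filter_univ, Finset.insert_subset_iff, Finset.mem_union,
      Finset.card_insert_of_notMem hi, add_left_inj]
    by_cases hiW : i ∈ W
    · have hiS : i ∉ S := Finset.disjoint_right.1 hSW hiW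
      simp only [Finset.insert_inter_of_mem hiW, Finset.card_insert_of_notMem hinter,
        add_left_inj, hiW, hiS]
      tauto
    · simp only [Finset.insert_inter_of_notMem hiW, hiW]
      tauto
  have hsplit : ∀ i, (if i ∈ R then (0 : ℝ)
      else if symmDiff R {i} ∈ crossSets S W (k + 1) (b + 1) then 1 else 0) =
      (if i ∈ S \ R then 1 else 0) * (if R ∈ crossSets S W k (b + 1) then 1 else 0) +
      (if i ∈ W \ R then 1 else 0) * (if R ∈ crossSets S W k b then 1 else 0) := by
    intro i
    by_cases hi : i ∈ R
    · simp [hi]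
    · have := hmem i hi
      by_cases hiS : i ∈ S
      · have hiW : i ∉ W := Finset.disjoint_left.1 hSW hiS
        simp [hi, this, hiS, hiW]
      · by_cases hiW : i ∈ W <;> simp [hi, this, hiS, hiW]
  have hcard : ∀ X : Finset (Fin n), ∑ i, (if i ∈ X \ R then (1 : ℝ) else 0) =
      X.card - (R ∩ X).card := by
    intro X
    have := Finset.card_sdiff_add_card_inter X R
    rw [Finset.inter_comm] at this
    rw [← this]
    simp only [Finset.sum_boole, Finset.filter_univ_mem]
    push_cast; ring
  simp only [mulSumDown, hsplit, Finset.sum_add_distrib, ← Finset.sum_mul, hcard]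
  congr 1
  · by_cases h : R ∈ crossSets S W k (b + 1)
    · simp only [crossSets, Finset.mem_filter_univ] at h
      obtain ⟨h1, h2, h3⟩ := h
      have h4 : (R ∩ S).card + (R ∩ W).card = R.card := by
        rw [← Finset.card_union_of_disjoint
          (hSW.mono Finset.inter_subset_right Finset.inter_subset_right),
          ← Finset.inter_union_distrib_left, Finset.inter_eq_left.2 h1]
      have h5 : ((R ∩ S).card : ℝ) + (b + 1) = k := by
        rw [h2, h3] at h4; exact_mod_cast h4
      rw [← h5]; ring
    · simp [h]
  · by_cases h : R ∈ crossSets S W k b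
    · simp only [crossSets, Finset.mem_filter_univ] at h
      rw [h.2.2]
    · simp [h]

/-- Summing `mulSumUp u` over the sets with `b + 1` elements in `W`, by double counting. -/
theorem sum_crossSets_mulSumUp {S W : Finset (Fin n)} (hSW : Disjoint S W) {d : ℕ}
    (hS : S.card = d) (hW : W.card = d + 1) (b : ℕ) (u : Finset (Fin n) → ℝ) :
    ∑ T ∈ crossSets S W (d + 1) (b + 1), mulSumUp u T =
      (b + 1) * ∑ R ∈ crossSets S W d (b + 1), u R +
        ((d : ℝ) + 1 - b) * ∑ R ∈ crossSets S W d b, u R := by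
  have h := sum_mul_mulSumUp
    (fun T => if T ∈ crossSets S W (d + 1) (b + 1) then (1 : ℝ) else 0) u
  simp only [mulSumDown_crossSets hSW, hS, hW] at h
  simp only [ite_mul, one_mul, zero_mul, mul_ite, mul_one, mul_zero, mul_add,
    Finset.sum_add_distrib, Finset.sum_ite_mem, Finset.univ_inter] at h
  rw [h]
  simp only [← Finset.sum_mul]
  push_cast; ring

theorem crossSets_zero {S W : Finset (Fin n)} (hSW : Disjoint S W) :
    crossSets S W S.card 0 = {S} := by
  ext T
  simp only [crossSets, Finset.mem_filter_univ, Finset.mem_singleton, Finset.card_eq_zero]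
  constructor
  · rintro ⟨h1, h2, h3⟩
    refine Finset.eq_of_subset_of_card_le (fun i hi => ?_) h2.ge
    rcases Finset.mem_union.1 (h1 hi) with h | h
    · exact h
    · exact absurd (Finset.mem_inter.2 ⟨hi, h⟩) (by simp [h3])
  · rintro rfl
    exact ⟨Finset.subset_union_left, rfl, Finset.disjoint_iff_inter_eq_empty.1 hSW⟩

theorem crossSets_eq_empty (S W : Finset (Fin n)) {k b : ℕ} (h : k < b) :
    crossSets S W k b = ∅ := by
  ext T
  simp only [crossSets, Finset.mem_filter_univ, Finset.notMem_empty, iff_false]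
  rintro ⟨-, h2, h3⟩
  have := Finset.card_le_card (Finset.inter_subset_left (s₁ := T) (s₂ := W))
  omega

theorem card_crossSets_le {S W : Finset (Fin n)} (k b : ℕ) :
    (crossSets S W k b).card ≤ 2 ^ (S.card + W.card) := by
  calc (crossSets S W k b).card ≤ (S ∪ W).powerset.card := Finset.card_le_card fun T hT => by
        simp only [crossSets, Finset.mem_filter_univ] at hT
        exact Finset.mem_powerset.2 hT.1
    _ = 2 ^ (S ∪ W).card := Finset.card_powerset _
    _ ≤ _ := Nat.pow_le_pow_right (by norm_num) (Finset.card_union_le _ _)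

end SymmDiff

section Rounding

variable {n : ℕ}

/-- If the up-part of `u` is close to multiples of `γ` on the sets meeting `W`, then `u S` is close
to a multiple of `γ / (d + 1)!`. -/
theorem exists_int_near_of_mulSumUp {d : ℕ} {γ τ : ℝ} (hτ : 0 ≤ τ) {S W : Finset (Fin n)}
    (hSW : Disjoint S W) (hS : S.card = d) (hW : W.card = d + 1) {c u : Finset (Fin n) → ℝ}
    (hc : ∀ T, ∃ m : ℤ, c T = m * γ)
    (hgood : ∀ T, T.card = d + 1 → (T ∩ W).Nonempty → |c T - mulSumUp u T| ≤ τ) :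
    ∃ m : ℤ, |u S - m * (γ / (d + 1).factorial)| ≤ 4 ^ (d + 1) * (d + 2) ^ (d + 1) * τ := by
  have hsum : ∀ b, ∃ m : ℤ,
      |∑ T ∈ crossSets S W (d + 1) (b + 1), mulSumUp u T - m * γ| ≤ 4 ^ (d + 1) * τ := by
    intro b
    choose m hm using hc
    refine ⟨∑ T ∈ crossSets S W (d + 1) (b + 1), m T, ?_⟩
    push_cast
    simp only [Finset.sum_mul, ← hm, ← Finset.sum_sub_distrib]
    calc _ ≤ ∑ T ∈ crossSets S W (d + 1) (b + 1), |mulSumUp u T - c T| :=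
          Finset.abs_sum_le_sum_abs _ _
      _ ≤ ∑ T ∈ crossSets S W (d + 1) (b + 1), τ := Finset.sum_le_sum fun T hT => by
          simp only [crossSets, Finset.mem_filter_univ] at hT
          rw [abs_sub_comm]
          exact hgood T hT.2.1 (Finset.card_pos.1 (by omega))
      _ = (crossSets S W (d + 1) (b + 1)).card * τ := by simp
      _ ≤ 4 ^ (d + 1) * τ := by
          refine mul_le_mul_of_nonneg_right ?_ hτ
          have h1 := card_crossSets_le (S := S) (W := W) (d + 1) (b + 1)
          have h2 : 2 ^ (S.card + W.card) ≤ 4 ^ (d + 1) := by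
            rw [show (4 : ℕ) = 2 ^ 2 from rfl, ← pow_mul]
            exact Nat.pow_le_pow_right (by norm_num) (by omega)
          exact_mod_cast h1.trans h2
  have key : ∀ k b, k + b = d + 1 → ∃ m : ℤ,
      |∑ R ∈ crossSets S W d b, u R - m * (γ / k.factorial)| ≤
        4 ^ (d + 1) * (d + 2) ^ k * τ := by
    intro k
    induction k with
    | zero =>
      intro b hb
      refine ⟨0, ?_⟩
      rw [crossSets_eq_empty S W (by omega)]
      simp only [Finset.sum_empty, Int.cast_zero, zero_mul, sub_zero, abs_zero]
      positivity
    | succ k ih =>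
      intro b hb
      obtain ⟨m₂, hm₂⟩ := ih (b + 1) (by omega)
      obtain ⟨m₁, hm₁⟩ := hsum b
      have hid := sum_crossSets_mulSumUp hSW hS hW b u
      have hk : (d : ℝ) + 1 - b = k + 1 := by
        have : (k : ℝ) + 1 + b = d + 1 := by exact_mod_cast hb
        linarith
      rw [hk] at hid
      have hb' : (b : ℝ) + 1 ≤ d + 1 := by
        have : b + 1 ≤ d + 1 := by omega
        exact_mod_cast this
      refine ⟨m₁ * k.factorial - (b + 1) * m₂, ?_⟩
      generalize ∑ T ∈ crossSets S W (d + 1) (b + 1), mulSumUp u T = P at *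
      generalize ∑ R ∈ crossSets S W d (b + 1), u R = Q₁ at *
      generalize ∑ R ∈ crossSets S W d b, u R = Q at *
      have hk0 : (0 : ℝ) < k + 1 := by positivity
      have hf0 : (0 : ℝ) < k.factorial := by positivity
      have e : Q - ((m₁ * k.factorial - (b + 1) * m₂ : ℤ) : ℝ) * (γ / (k + 1).factorial) =
          ((P - m₁ * γ) - (b + 1) * (Q₁ - m₂ * (γ / k.factorial))) / (k + 1) := by
        rw [hid, Nat.factorial_succ]
        push_cast
        field_simp
        ring
      rw [e, abs_div, abs_of_pos hk0]
      have hY : (1 : ℝ) ≤ (d + 2) ^ k := one_le_pow₀ (by linarith [(Nat.cast_nonneg d : (0:ℝ) ≤ d)])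
      have hX : 0 ≤ (4 : ℝ) ^ (d + 1) * τ := by positivity
      calc _ ≤ |(P - m₁ * γ) - (b + 1) * (Q₁ - m₂ * (γ / k.factorial))| :=
            div_le_self (abs_nonneg _) (by linarith [(Nat.cast_nonneg k : (0:ℝ) ≤ k)])
        _ ≤ |P - m₁ * γ| + |((b : ℝ) + 1) * (Q₁ - m₂ * (γ / k.factorial))| := abs_sub _ _
        _ = |P - m₁ * γ| + (b + 1) * |Q₁ - m₂ * (γ / k.factorial)| := by
            rw [abs_mul, abs_of_nonneg (by positivity : (0 : ℝ) ≤ (b : ℝ) + 1)]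
        _ ≤ 4 ^ (d + 1) * τ + (d + 1) * (4 ^ (d + 1) * (d + 2) ^ k * τ) := by gcongr
        _ ≤ 4 ^ (d + 1) * (d + 2) ^ (k + 1) * τ := by
            rw [pow_succ ((d : ℝ) + 2) k]
            nlinarith [mul_le_mul_of_nonneg_left hY hX]
  obtain ⟨m, hm⟩ := key (d + 1) 0 rfl
  have h0 : crossSets S W d 0 = {S} := hS ▸ crossSets_zero hSW
  rw [h0, Finset.sum_singleton] at hm
  exact ⟨m, hm⟩

/-- Few sets can be far from the lattice, so any `S` is disjoint from a large set of coordinates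
meeting none of them. -/
theorem exists_disjoint_good {d : ℕ} {τ K : ℝ} (hτ : 0 < τ) (r : Finset (Fin n) → ℝ)
    (hr : ∑ T with T.card = d + 1, r T ^ 2 ≤ K * τ ^ 2)
    (hn : (d + 1) * K + (2 * d + 1) ≤ n) {S : Finset (Fin n)} (hS : S.card = d) :
    ∃ W : Finset (Fin n), Disjoint S W ∧ W.card = d + 1 ∧
      ∀ T, T.card = d + 1 → (T ∩ W).Nonempty → |r T| ≤ τ := by
  set B : Finset (Finset (Fin n)) := {T | T.card = d + 1 ∧ τ < |r T|} with hB
  have hBcard : (B.card : ℝ) ≤ K := by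
    refine le_of_mul_le_mul_right (le_trans ?_ hr) (by positivity : 0 < τ ^ 2)
    calc (B.card : ℝ) * τ ^ 2 = ∑ T ∈ B, τ ^ 2 := by simp
      _ ≤ ∑ T ∈ B, r T ^ 2 := Finset.sum_le_sum fun T hT => by
          rw [← sq_abs (r T)]
          exact pow_le_pow_left₀ hτ.le (Finset.mem_filter.1 hT).2.2.le 2
      _ ≤ _ := Finset.sum_le_sum_of_subset_of_nonneg
          (fun T hT => Finset.mem_filter.2 ⟨Finset.mem_univ _, (Finset.mem_filter.1 hT).2.1⟩)
          fun _ _ _ => sq_nonneg _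
  have hX : (B.biUnion id).card ≤ B.card * (d + 1) :=
    Finset.card_biUnion_le_card_mul _ _ _ fun T hT => (Finset.mem_filter.1 hT).2.1.le
  have hU : (S ∪ B.biUnion id).card + (d + 1) ≤ n := by
    have h1 := Finset.card_union_le S (B.biUnion id)
    have h2 : (B.card : ℝ) * (d + 1) + (2 * d + 1) ≤ n := by nlinarith
    have h3 : B.card * (d + 1) + (2 * d + 1) ≤ n := by exact_mod_cast h2
    omega
  obtain ⟨W, hWsub, hWcard⟩ : ∃ W ⊆ (S ∪ B.biUnion id)ᶜ, W.card = d + 1 :=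
    Finset.exists_subset_card_eq (by rw [Finset.card_compl, Fintype.card_fin]; omega)
  have hdisj : ∀ i ∈ W, i ∉ S ∪ B.biUnion id := fun i hi => Finset.mem_compl.1 (hWsub hi)
  refine ⟨W, Finset.disjoint_right.2 fun i hi h => hdisj i hi (Finset.mem_union_left _ h), hWcard,
    fun T hT hTW => ?_⟩
  by_contra hcon
  obtain ⟨i, hi⟩ := hTW
  obtain ⟨hiT, hiW⟩ := Finset.mem_inter.1 hi
  exact hdisj i hiW (Finset.mem_union_right _ (Finset.mem_biUnion.2
    ⟨T, Finset.mem_filter.2 ⟨Finset.mem_univ _, hT, not_le.1 hcon⟩, hiT⟩))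

theorem abs_mulSumUp_le {h : Finset (Fin n) → ℝ} {a : ℝ} (hh : ∀ S, |h S| ≤ a)
    (T : Finset (Fin n)) : |mulSumUp h T| ≤ T.card * a := by
  calc |mulSumUp h T| = |∑ i ∈ T, h (symmDiff T {i})| := by
        simp [mulSumUp, Finset.sum_ite_mem]
    _ ≤ ∑ i ∈ T, |h (symmDiff T {i})| := Finset.abs_sum_le_sum_abs _ _
    _ ≤ ∑ i ∈ T, a := Finset.sum_le_sum fun i _ => hh _
    _ = T.card * a := by simp

theorem mulSumUp_sub (g h : Finset (Fin n) → ℝ) (T : Finset (Fin n)) :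
    mulSumUp (fun S => g S - h S) T = mulSumUp g T - mulSumUp h T := by
  simp only [mulSumUp, ← Finset.sum_sub_distrib]
  refine Finset.sum_congr rfl fun i _ => ?_
  split_ifs <;> simp

theorem exists_int_mulSumUp {g : ℝ} {h : Finset (Fin n) → ℝ} (hh : ∀ S, ∃ m : ℤ, h S = m * g)
    (T : Finset (Fin n)) : ∃ m : ℤ, mulSumUp h T = m * g := by
  choose m hm using hh
  refine ⟨∑ i, if i ∈ T then m (symmDiff T {i}) else 0, ?_⟩
  simp only [mulSumUp, Int.cast_sum, Finset.sum_mul]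
  refine Finset.sum_congr rfl fun i _ => ?_
  split_ifs <;> simp [hm]

theorem exists_int_mulSum {g : ℝ} {h : Finset (Fin n) → ℝ} (hh : ∀ S, ∃ m : ℤ, h S = m * g)
    (T : Finset (Fin n)) : ∃ m : ℤ, mulSum h T = m * g := by
  choose m hm using hh
  refine ⟨∑ i, m (symmDiff T {i}), ?_⟩
  simp only [mulSum, Int.cast_sum, Finset.sum_mul, hm]

theorem exists_int_div {γ : ℝ} {N : ℕ} (hN : N ≠ 0) {x : ℝ} (hx : ∃ m : ℤ, x = m * γ) :
    ∃ m : ℤ, x = m * (γ / N) := by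
  obtain ⟨m, rfl⟩ := hx
  have : (N : ℝ) ≠ 0 := by exact_mod_cast hN
  exact ⟨m * N, by push_cast; field_simp⟩

end Rounding

/-- Rounding a homogeneous `u` whose up-part is close to the lattice `γℤ`. -/
theorem exists_rounding (d : ℕ) {γ : ℝ} (hγ : 0 < γ) {A : ℝ} (hA : 0 ≤ A) :
    ∃ n₀ : ℕ, ∀ n : ℕ, n₀ ≤ n → ∀ c : Finset (Fin n) → ℝ, (∀ T, ∃ m : ℤ, c T = m * γ) →
      ∀ u : Finset (Fin n) → ℝ, (∀ S, S.card ≠ d → u S = 0) →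
        ∑ T with T.card = d + 1, (c T - mulSumUp u T) ^ 2 ≤ A * √n →
        ∃ v : Finset (Fin n) → ℝ, (∀ S, S.card ≠ d → v S = 0) ∧
          (∀ S, ∃ m : ℤ, v S = m * (γ / (d + 1).factorial)) ∧
          ∀ T, T.card = d + 1 →
            |mulSumUp (fun S => u S - v S) T| ≤ |c T - mulSumUp u T| ∧
              |c T - mulSumUp v T| ≤ 2 * |c T - mulSumUp u T| := by
  set g : ℝ := γ / (d + 1).factorial with hg
  have hg0 : 0 < g := by positivity
  set M : ℝ := 4 ^ (d + 1) * (d + 2) ^ (d + 1) with hM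
  have hM0 : 0 < M := by positivity
  set τ : ℝ := g / (2 * (d + 1) * M) with hτ
  have hτ0 : 0 < τ := by positivity
  have hMτ : (d + 1) * (M * τ) = g / 2 := by rw [hτ]; field_simp
  set L : ℝ := (d + 1) * (A / τ ^ 2) + (2 * d + 1) with hL
  have hL1 : 1 ≤ L := by
    have : 0 ≤ (d + 1) * (A / τ ^ 2) := by positivity
    have : (0 : ℝ) ≤ d := by positivity
    linarith
  refine ⟨⌈L ^ 2⌉₊, fun n hn c hc u hu hr => ?_⟩
  have hnL : L ^ 2 ≤ n := Nat.ceil_le.1 hn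
  have hsqrt : L ≤ √n := Real.le_sqrt_of_sq_le hnL
  have hn' : (d + 1) * (A * √n / τ ^ 2) + (2 * d + 1) ≤ n := by
    have h1 : √n * √n = n := Real.mul_self_sqrt (Nat.cast_nonneg n)
    have h2 : L * √n ≤ n := by nlinarith
    have h3 : (2 * d + 1 : ℝ) ≤ (2 * d + 1) * √n :=
      le_mul_of_one_le_right (by positivity) (hL1.trans hsqrt)
    calc _ ≤ (d + 1) * (A * √n / τ ^ 2) + (2 * d + 1) * √n := by linarith
      _ = L * √n := by rw [hL]; ring
      _ ≤ n := h2
  have hnear : ∀ S : Finset (Fin n), ∃ m : ℤ, S.card = d → |u S - m * g| ≤ M * τ := by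
    intro S
    by_cases hS : S.card = d
    · obtain ⟨W, hSW, hW, hgood⟩ := exists_disjoint_good hτ0 (fun T => c T - mulSumUp u T)
        (hr.trans_eq (div_mul_cancel₀ _ (by positivity)).symm) hn' hS
      obtain ⟨m, hm⟩ := exists_int_near_of_mulSumUp hτ0.le hSW hS hW hc hgood
      exact ⟨m, fun _ => hm⟩
    · exact ⟨0, fun h => absurd h hS⟩
  choose m hm using hnear
  have hv : ∀ S : Finset (Fin n), ∃ k : ℤ, (if S.card = d then (m S : ℝ) * g else 0) = k * g := by
    intro S
    split_ifs
    · exact ⟨m S, rfl⟩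
    · exact ⟨0, by simp⟩
  refine ⟨fun S => if S.card = d then m S * g else 0, fun S hS => if_neg hS, hv, fun T hT => ?_⟩
  have hδ : |mulSumUp (fun S => u S - if S.card = d then (m S : ℝ) * g else 0) T| ≤ g / 2 := by
    rw [← hMτ]
    refine (abs_mulSumUp_le (a := M * τ) (fun S => ?_) T).trans_eq (by rw [hT]; push_cast; rfl)
    split_ifs with hS
    · exact hm S hS
    · rw [hu S hS]; simp only [sub_zero, abs_zero]; positivity
  obtain ⟨z, hz⟩ : ∃ z : ℤ,
      c T - mulSumUp (fun S => if S.card = d then (m S : ℝ) * g else 0) T = z * g := by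
    obtain ⟨k₁, hk₁⟩ := exists_int_div (Nat.factorial_ne_zero (d + 1)) (hc T)
    obtain ⟨k₂, hk₂⟩ := exists_int_mulSumUp hv T
    exact ⟨k₁ - k₂, by rw [hk₁, hk₂]; push_cast; ring⟩
  rw [mulSumUp_sub] at hδ ⊢
  generalize mulSumUp (fun S => if S.card = d then (m S : ℝ) * g else 0) T = V at *
  generalize mulSumUp u T = U at *
  rcases eq_or_ne z 0 with rfl | hz0
  · have hV : c T = V := by simpa [sub_eq_zero] using hz
    rw [← hV, abs_sub_comm]
    simp
  · have h1 : g ≤ |c T - V| := by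
      rw [hz, abs_mul, abs_of_pos hg0]
      have : (1 : ℝ) ≤ |(z : ℝ)| := by exact_mod_cast Int.one_le_abs hz0
      nlinarith
    have h2 : |c T - V| ≤ |c T - U| + |U - V| := abs_sub_le _ _ _
    constructor <;> linarith

/-- If `c` has degree at most `d`, coefficients in `γℤ`, and is close to a multiple of `∑ i, x i`,
then it is close to the product of `∑ i, x i` and a polynomial with coefficients in a fixed
lattice. -/
theorem exists_lattice_approx (d : ℕ) : ∀ {γ : ℝ}, 0 < γ → ∀ {A : ℝ}, 0 ≤ A →
    ∃ n₀ : ℕ, ∀ n : ℕ, n₀ ≤ n → ∀ c : Finset (Fin n) → ℝ, (∀ S, d < S.card → c S = 0) →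
      (∀ S, ∃ m : ℤ, c S = m * γ) → ∀ f : Finset (Fin n) → ℝ, (∀ S, d ≤ S.card → f S = 0) →
        ∑ T, (c T - mulSum f T) ^ 2 ≤ A * √n →
        ∃ h : Finset (Fin n) → ℝ, (∀ S, d ≤ S.card → h S = 0) ∧
          (∀ S, ∃ m : ℤ, h S = m * (γ / ∏ j ∈ Finset.Icc 2 d, (j.factorial : ℝ))) ∧
          ∑ T, (c T - mulSum h T) ^ 2 ≤ 7 ^ d * ∑ T, (c T - mulSum f T) ^ 2 := by
  induction d with
  | zero =>
    intro γ _ A _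
    exact ⟨0, fun n _ c _ _ f hf _ => ⟨f, hf, fun S => ⟨0, by simp [hf S]⟩, by simp⟩⟩
  | succ d ih =>
    intro γ hγ A hA
    obtain ⟨n₁, h₁⟩ := exists_rounding d hγ hA
    obtain ⟨n₂, h₂⟩ := ih (γ := γ / (d + 1).factorial) (by positivity) (A := 2 * A) (by positivity)
    refine ⟨max (max n₁ n₂) (2 * d), fun n hn c hcd hc f hf hE => ?_⟩
    have hprod : ∏ j ∈ Finset.Icc 2 (d + 1), (j.factorial : ℝ) =
        (d + 1).factorial * ∏ j ∈ Finset.Icc 2 d, (j.factorial : ℝ) := by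
      rcases Nat.eq_zero_or_pos d with rfl | hd
      · simp
      · rw [Finset.prod_Icc_succ_top (by omega), mul_comm]
    set E := ∑ T, (c T - mulSum f T) ^ 2 with hEdef
    have hsplit : ∀ F : Finset (Fin n) → ℝ,
        ∑ T, F T = ∑ T with T.card = d + 1, F T + ∑ T with ¬ T.card = d + 1, F T := fun F =>
      (Finset.sum_filter_add_sum_filter_not _ _ _).symm
    set u : Finset (Fin n) → ℝ := fun S => if S.card = d then f S else 0 with hu
    set l : Finset (Fin n) → ℝ := fun S => if S.card = d then 0 else f S with hl
    have hu0 : ∀ S, S.card ≠ d → u S = 0 := fun S hS => if_neg hS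
    have hl0 : ∀ S, d ≤ S.card → l S = 0 := fun S hS => by
      simp only [hl]
      split_ifs with h
      · rfl
      · exact hf S (by omega)
    have hful : ∀ T, mulSum f T = mulSum u T + mulSum l T := fun T => by
      rw [← mulSum_add]
      congr 1
      funext S
      simp only [hu, hl]
      split_ifs <;> simp
    have htop : ∀ w : Finset (Fin n) → ℝ, (∀ S, S.card ≠ d → w S = 0) →
        ∀ T, T.card = d + 1 → mulSum w T = mulSumUp w T := fun w hw T hT => by
      rw [mulSum_eq_up_add_down,
        mulSumDown_eq_zero (fun S hS => hw S (by omega : S.card ≠ d)) (by omega : d ≤ T.card),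
        add_zero]
    have hlow : ∀ w : Finset (Fin n) → ℝ, (∀ S, S.card ≠ d → w S = 0) →
        ∀ T, T.card ≠ d + 1 → mulSum w T = mulSumDown w T := fun w hw T hT => by
      rw [mulSum_eq_up_add_down, mulSumUp_eq_zero hw hT, zero_add]
    have hftop : ∀ T : Finset (Fin n), T.card = d + 1 → mulSum f T = mulSumUp u T := fun T hT => by
      rw [hful, htop u hu0 T hT, mulSum_eq_zero hl0 (by omega), add_zero]
    have hEtop : ∑ T with T.card = d + 1, (c T - mulSumUp u T) ^ 2 =
        ∑ T with T.card = d + 1, (c T - mulSum f T) ^ 2 :=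
      Finset.sum_congr rfl fun T hT => by rw [hftop T (Finset.mem_filter.1 hT).2]
    have hElow : 0 ≤ ∑ T with ¬ T.card = d + 1, (c T - mulSum f T) ^ 2 :=
      Finset.sum_nonneg fun _ _ => sq_nonneg _
    have hEsplit := hsplit fun T => (c T - mulSum f T) ^ 2
    obtain ⟨v, hv0, hvint, hvT⟩ := h₁ n (by omega) c hc u hu0 (by rw [hEtop]; linarith)
    set δ : Finset (Fin n) → ℝ := fun S => u S - v S with hδ
    have hδ0 : ∀ S, S.card ≠ d → δ S = 0 := fun S hS => by simp [hδ, hu0 S hS, hv0 S hS]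
    have hδdown : ∑ T, mulSumDown δ T ^ 2 ≤
        ∑ T with T.card = d + 1, (c T - mulSum f T) ^ 2 := by
      refine (sum_mulSumDown_sq_le (d := d) (by omega) fun S hS => hδ0 S (by omega)).trans ?_
      rw [hsplit fun T => mulSumUp δ T ^ 2, ← hEtop]
      have hvanish : ∑ T with ¬ T.card = d + 1, mulSumUp δ T ^ 2 = 0 :=
        Finset.sum_eq_zero fun T hT => by
          rw [mulSumUp_eq_zero hδ0 (Finset.mem_filter.1 hT).2]; norm_num
      rw [hvanish, add_zero]
      exact Finset.sum_le_sum fun T hT => sq_le_sq.2 (hvT T (Finset.mem_filter.1 hT).2).1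
    set c' : Finset (Fin n) → ℝ := fun T => if T.card ≤ d then c T - mulSum v T else 0 with hc'
    have hc'd : ∀ S, d < S.card → c' S = 0 := fun S hS => if_neg (by omega)
    have hc'low : ∀ T, T.card ≠ d + 1 → c' T = c T - mulSum v T := fun T hT => by
      by_cases h : T.card ≤ d
      · exact if_pos h
      · rw [hc'd T (by omega), hcd T (by omega),
          mulSum_eq_zero (fun S hS => hv0 S (by omega : S.card ≠ d)) (by omega : d + 1 < T.card),
          sub_zero]
    have hc'int : ∀ S, ∃ m : ℤ, c' S = m * (γ / (d + 1).factorial) := fun S => by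
      obtain ⟨k₁, hk₁⟩ := exists_int_div (Nat.factorial_ne_zero (d + 1)) (hc S)
      obtain ⟨k₂, hk₂⟩ := exists_int_mulSum hvint S
      by_cases h : S.card ≤ d
      · exact ⟨k₁ - k₂, by simp only [hc', if_pos h]; rw [hk₁, hk₂]; push_cast; ring⟩
      · exact ⟨0, by simp [hc', h]⟩
    have hE' : ∑ T, (c' T - mulSum l T) ^ 2 ≤ 2 * E := by
      rw [hsplit fun T => (c' T - mulSum l T) ^ 2]
      rw [Finset.sum_eq_zero fun T hT => by
        have hT' := (Finset.mem_filter.1 hT).2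
        rw [hc'd T (by omega), mulSum_eq_zero hl0 (by omega : d < T.card)]; norm_num, zero_add]
      calc ∑ T with ¬ T.card = d + 1, (c' T - mulSum l T) ^ 2
          ≤ ∑ T with ¬ T.card = d + 1,
              (2 * (c T - mulSum f T) ^ 2 + 2 * mulSumDown δ T ^ 2) := by
            refine Finset.sum_le_sum fun T hT => ?_
            have hT' := (Finset.mem_filter.1 hT).2
            have hd : mulSum u T = mulSum v T + mulSumDown δ T := by
              rw [← hlow δ hδ0 T hT', ← mulSum_add]
              congr 1
              funext S
              simp [hδ]
            rw [hc'low T hT', hful T, hd]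
            nlinarith [sq_nonneg (c T - (mulSum v T + mulSumDown δ T + mulSum l T)
              - mulSumDown δ T)]
        _ ≤ 2 * ∑ T with ¬ T.card = d + 1, (c T - mulSum f T) ^ 2 +
              2 * ∑ T, mulSumDown δ T ^ 2 := by
            rw [Finset.sum_add_distrib, ← Finset.mul_sum, ← Finset.mul_sum]
            gcongr
            exact Finset.filter_subset _ _
        _ ≤ 2 * E := by rw [hEdef, hEsplit]; linarith
    obtain ⟨h', hh'0, hh'int, hh'⟩ := h₂ n (by omega) c' hc'd hc'int l hl0 (by linarith)
    refine ⟨fun S => v S + h' S, fun S hS => ?_, fun S => ?_, ?_⟩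
    · simp [hv0 S (by omega), hh'0 S (by omega)]
    · rw [hprod, ← div_div]
      obtain ⟨k₁, hk₁⟩ := exists_int_div
        (Finset.prod_ne_zero_iff.2 fun j (_ : j ∈ Finset.Icc 2 d) => Nat.factorial_ne_zero j)
        (hvint S)
      obtain ⟨k₂, hk₂⟩ := hh'int S
      push_cast at hk₁
      refine ⟨k₁ + k₂, ?_⟩
      simp only [hk₁, hk₂]
      push_cast
      ring
    · have hcl : ∑ T with ¬ T.card = d + 1, (c T - mulSum (fun S => v S + h' S) T) ^ 2 ≤
          ∑ T, (c' T - mulSum h' T) ^ 2 := by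
        refine le_trans (le_of_eq (Finset.sum_congr rfl fun T hT => ?_))
          (Finset.sum_le_sum_of_subset_of_nonneg (Finset.filter_subset _ _)
            fun _ _ _ => sq_nonneg _)
        rw [hc'low T (Finset.mem_filter.1 hT).2, mulSum_add]
        ring
      have hct : ∑ T with T.card = d + 1, (c T - mulSum (fun S => v S + h' S) T) ^ 2 ≤
          4 * ∑ T with T.card = d + 1, (c T - mulSum f T) ^ 2 := by
        rw [Finset.mul_sum]
        refine Finset.sum_le_sum fun T hT => ?_
        have hT' := (Finset.mem_filter.1 hT).2
        rw [mulSum_add, mulSum_eq_zero hh'0 (by omega : d < T.card), add_zero, htop v hv0 T hT',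
          hftop T hT']
        have := pow_le_pow_left₀ (abs_nonneg _) (hvT T hT').2 2
        rw [mul_pow, sq_abs, sq_abs] at this
        linarith
      have hE0 : 0 ≤ E := Finset.sum_nonneg fun _ _ => sq_nonneg _
      have h7 : (1 : ℝ) ≤ 7 ^ d := one_le_pow₀ (by norm_num)
      have h7E : E ≤ 7 ^ d * E := le_mul_of_one_le_left hE0 h7
      have h7E' : 7 ^ d * ∑ T, (c' T - mulSum l T) ^ 2 ≤ 7 ^ d * (2 * E) := by gcongr
      rw [hsplit fun T => (c T - mulSum (fun S => v S + h' S) T) ^ 2, pow_succ]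
      nlinarith

theorem stmt10 (d : ℕ) (hd : 1 ≤ d) (γ : ℝ) (hγ : 0 < γ) :
    ∃ n₀ : ℕ, ∀ n : ℕ, n₀ ≤ n → Even n →
      ∀ c : Finset (Fin n) → ℝ,
        (∀ S, d < S.card → c S = 0) →
        (∀ S, ∃ m : ℤ, c S = m * γ) →
      ∀ hf : Finset (Fin n) → ℝ, (∀ S, d - 1 < S.card → hf S = 0) →
        (∀ h' : Finset (Fin n) → ℝ, (∀ S, d - 1 < S.card → h' S = 0) →
          ∑ T : Finset (Fin n), (c T - mulSum hf T) ^ 2 ≤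
            ∑ T : Finset (Fin n), (c T - mulSum h' T) ^ 2) →
        (∑ T : Finset (Fin n), (c T - mulSum hf T) ^ 2) ≤ Real.sqrt n →
        ∃ h : Finset (Fin n) → ℝ, (∀ S, d - 1 < S.card → h S = 0) ∧
          (∀ S, ∃ m : ℤ,
            h S = m * (γ / ∏ j ∈ Finset.Icc 2 d, (Nat.factorial j : ℝ))) ∧
          ∑ T : Finset (Fin n), (c T - mulSum h T) ^ 2 ≤
            7 ^ d * ∑ T : Finset (Fin n), (c T - mulSum hf T) ^ 2 := by
  obtain ⟨n₀, h₀⟩ := exists_lattice_approx d hγ zero_le_one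
  refine ⟨n₀, fun n hn _ c hcd hc hf hhf _ hE => ?_⟩
  obtain ⟨h, hh0, hhint, hh⟩ :=
    h₀ n hn c hcd hc hf (fun S hS => hhf S (by omega)) (by rwa [one_mul])
  exact ⟨h, fun S hS => hh0 S (by omega), hhint, hh⟩
end

section
/- Let d ≥ 1, n ≥ 3d, and γ > 0. Let a : {T ⊆ [n] : |T| = d} → ℝ be such that every a(T) is an integer multiple of γ, and let h : {S ⊆ [n] : |S| = d−1} → ℝ satisfy a(T) = Σ_{S ⊂ T, |S| = d−1} h(S) for every T ⊆ [n] with |T| = d. Then h(S) is an integer multiple of γ/d! for every S ⊆ [n] with |S| = d−1. -/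
open Finset

theorem sum_powersetCard_pred_eq_sum_erase {α M : Type*} [DecidableEq α] [AddCommMonoid M]
    (f : Finset α → M) {T : Finset α} {k : ℕ} (hT : T.card = k + 1) :
    ∑ S ∈ powersetCard k T, f S = ∑ t ∈ T, f (T.erase t) := by
  symm
  refine sum_bij (fun t _ => T.erase t) ?_ ?_ ?_ (fun _ _ => rfl)
  · intro t ht
    simp [mem_powersetCard, erase_subset, card_erase_of_mem ht, hT]
  · intro s hs t _ hst
    by_contra hne
    have : s ∈ T.erase t := mem_erase.2 ⟨hne, hs⟩
    rw [← hst] at this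
    simp at this
  · intro S hS
    obtain ⟨hST, hSk⟩ := mem_powersetCard.1 hS
    have hcard : (T \ S).card = 1 := by rw [card_sdiff_of_subset hST]; omega
    obtain ⟨t, ht⟩ := card_eq_one.1 hcard
    refine ⟨t, (mem_sdiff.1 (ht ▸ mem_singleton_self t)).1, ?_⟩
    rw [← sdiff_singleton_eq_erase, ← ht, Finset.sdiff_sdiff_eq_self hST]

theorem sum_powersetCard_succ_sum_erase {α M : Type*} [DecidableEq α] [AddCommMonoid M]
    (g : Finset α → M) (R : Finset α) (m : ℕ) :
    ∑ Q ∈ powersetCard (m + 1) R, ∑ q ∈ Q, g (Q.erase q) =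
      (R.card - m) • ∑ Q ∈ powersetCard m R, g Q := by
  have hconst : (R.card - m) • ∑ Q ∈ powersetCard m R, g Q =
      ∑ Q ∈ powersetCard m R, ∑ _q ∈ R \ Q, g Q := by
    rw [smul_sum]
    refine sum_congr rfl fun Q hQ => ?_
    obtain ⟨hQR, hQm⟩ := mem_powersetCard.1 hQ
    rw [sum_const, card_sdiff_of_subset hQR, hQm]
  rw [hconst, sum_sigma', sum_sigma']
  refine sum_bij' (fun x _ => ⟨x.1.erase x.2, x.2⟩) (fun x _ => ⟨insert x.2 x.1, x.2⟩)
    ?_ ?_ ?_ ?_ (fun _ _ => rfl)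
  · rintro ⟨Q, q⟩ hx
    simp only [mem_sigma, mem_powersetCard, mem_sdiff] at hx ⊢
    obtain ⟨⟨hQR, hQm⟩, hq⟩ := hx
    exact ⟨⟨(erase_subset _ _).trans hQR, by rw [card_erase_of_mem hq]; omega⟩,
      hQR hq, notMem_erase _ _⟩
  · rintro ⟨Q, q⟩ hx
    simp only [mem_sigma, mem_powersetCard, mem_sdiff] at hx ⊢
    obtain ⟨⟨hQR, hQm⟩, hqR, hq⟩ := hx
    exact ⟨⟨insert_subset hqR hQR, by rw [card_insert_of_notMem hq, hQm]⟩, mem_insert_self _ _⟩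
  · rintro ⟨Q, q⟩ hx
    simp only [mem_sigma] at hx
    simp [insert_erase hx.2]
  · rintro ⟨Q, q⟩ hx
    simp only [mem_sigma, mem_sdiff] at hx
    simp [erase_insert hx.2.2]

/-- If the sums of `h` over the facets of every `(e + 1)`-set lie in a subgroup `K`, then so does
`(k + 1)!` times the sum of `h` over the `e`-sets `P ∪ Q` with `Q ⊆ R`, where `P` is a `k`-set
and `R` is an `(e + 1)`-set disjoint from `P`. -/
theorem factorial_smul_sum_union_mem {α M : Type*} [DecidableEq α] [AddCommGroup M]
    (K : AddSubgroup M) (h : Finset α → M) (e : ℕ)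
    (hK : ∀ T : Finset α, T.card = e + 1 → ∑ t ∈ T, h (T.erase t) ∈ K)
    {R : Finset α} (hR : R.card = e + 1) (k : ℕ) (hk : k ≤ e)
    (P : Finset α) (hP : P.card = k) (hPR : Disjoint P R) :
    (k + 1).factorial • ∑ Q ∈ powersetCard (e - k) R, h (P ∪ Q) ∈ K := by
  induction k generalizing P with
  | zero =>
    obtain rfl := card_eq_zero.1 hP
    simpa [sum_powersetCard_pred_eq_sum_erase h hR] using hK R hR
  | succ k ih =>
    have hsplit : ∀ Q ∈ powersetCard (e - k) R, ∑ t ∈ P ∪ Q, h ((P ∪ Q).erase t) =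
        ∑ p ∈ P, h (P.erase p ∪ Q) + ∑ q ∈ Q, h (P ∪ Q.erase q) := by
      intro Q hQ
      have hPQ : Disjoint P Q := hPR.mono_right (mem_powersetCard.1 hQ).1
      rw [sum_union hPQ]
      congr 1
      · refine sum_congr rfl fun p hp => ?_
        rw [erase_union_distrib, erase_eq_of_notMem (disjoint_left.1 hPQ hp)]
      · refine sum_congr rfl fun q hq => ?_
        rw [erase_union_distrib, erase_eq_of_notMem (disjoint_right.1 hPQ hq)]
    have htotal : ∑ Q ∈ powersetCard (e - k) R, ∑ t ∈ P ∪ Q, h ((P ∪ Q).erase t) ∈ K := by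
      refine sum_mem fun Q hQ => hK _ ?_
      obtain ⟨hQR, hQk⟩ := mem_powersetCard.1 hQ
      rw [card_union_of_disjoint (hPR.mono_right hQR)]
      omega
    have hcount := sum_powersetCard_succ_sum_erase (fun Q => h (P ∪ Q)) R (e - (k + 1))
    rw [show e - (k + 1) + 1 = e - k by omega,
      show R.card - (e - (k + 1)) = k + 1 + 1 by omega] at hcount
    rw [sum_congr rfl hsplit, sum_add_distrib, hcount, sum_comm] at htotal
    have hlower : (k + 1).factorial •
        ∑ p ∈ P, ∑ Q ∈ powersetCard (e - k) R, h (P.erase p ∪ Q) ∈ K := by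
      rw [smul_sum]
      refine sum_mem fun p hp => ih (by omega) _ ?_ (hPR.mono_left (erase_subset _ _))
      rw [card_erase_of_mem hp]
      omega
    have hscaled := K.nsmul_mem htotal (k + 1).factorial
    rw [smul_add, K.add_mem_cancel_left hlower, smul_smul] at hscaled
    rwa [Nat.factorial_succ (k + 1), mul_comm]

theorem stmt11 (n d : ℕ) (hd : 1 ≤ d) (hn : 3 * d ≤ n) (γ : ℝ) (hγ : 0 < γ)
    (a h : Finset (Fin n) → ℝ)
    (hmult : ∀ T : Finset (Fin n), T.card = d → ∃ m : ℤ, a T = m * γ)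
    (heq : ∀ T : Finset (Fin n), T.card = d →
      a T = ∑ S ∈ Finset.powersetCard (d - 1) T, h S) :
    ∀ S : Finset (Fin n), S.card = d - 1 →
      ∃ m : ℤ, h S = m * (γ / Nat.factorial d) := by
  intro S hS
  obtain ⟨e, rfl⟩ : ∃ e, d = e + 1 := ⟨d - 1, by omega⟩
  rw [Nat.add_sub_cancel] at hS heq
  have hcompl : e + 1 ≤ Sᶜ.card := by
    rw [card_compl, Fintype.card_fin]
    omega
  obtain ⟨R, hRS, hR⟩ := exists_subset_card_eq hcompl
  have hK : ∀ T : Finset (Fin n), T.card = e + 1 →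
      ∑ t ∈ T, h (T.erase t) ∈ AddSubgroup.zmultiples γ := by
    intro T hT
    obtain ⟨m, hm⟩ := hmult T hT
    rw [← sum_powersetCard_pred_eq_sum_erase h hT, ← heq T hT, hm]
    exact AddSubgroup.mem_zmultiples_iff.2 ⟨m, by simp⟩
  have hmem := factorial_smul_sum_union_mem _ h e hK hR e le_rfl S hS
    (disjoint_compl_right.mono_right hRS)
  obtain ⟨m, hm⟩ := AddSubgroup.mem_zmultiples_iff.1 hmem
  refine ⟨m, ?_⟩
  simp only [Nat.sub_self, powersetCard_zero, sum_singleton, union_empty, zsmul_eq_mul,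
    nsmul_eq_mul] at hm
  have hfac : ((e + 1).factorial : ℝ) ≠ 0 := by positivity
  rw [← mul_div_assoc, hm, mul_div_cancel_left₀ _ hfac]
end

section
/- Let d ≥ 1 and γ > 0. Let h, h' : {S ⊆ [n] : |S| = d−1} → ℝ be such that for every S, h'(S) is an integer multiple of γ/d! and |h'(S) − h(S)| < (0.1/d)·(γ/d!). Then for every α : {T ⊆ [n] : |T| = d} → ℝ with each α(T) an integer multiple of γ, Σ_{T ⊆ [n], |T| = d} ( Σ_{S ⊂ T, |S| = d−1} (h'(S) − h(S)) )² ≤ Σ_{T ⊆ [n], |T| = d} ( α(T) − Σ_{S ⊂ T, |S| = d−1} h(S) )². -/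
open Finset

/-- A perturbation `e` of size at most `u / 2` is no larger than its translate by any
integer multiple of `u`. -/
lemma sq_le_sq_int_mul_add {u e : ℝ} (k : ℤ) (he : |e| ≤ u / 2) :
    e ^ 2 ≤ (k * u + e) ^ 2 := by
  obtain ⟨h₁, h₂⟩ := abs_le.mp he
  have hu : 0 ≤ u := by linarith
  rcases lt_trichotomy k 0 with hk | rfl | hk
  · have hk' : (k : ℝ) ≤ -1 := by exact_mod_cast Int.le_sub_one_of_lt hk
    have : (k : ℝ) * u ≤ -u := by nlinarith
    nlinarith
  · simp
  · have hk' : (1 : ℝ) ≤ k := by exact_mod_cast hk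
    have : u ≤ (k : ℝ) * u := by nlinarith
    nlinarith

/-- A finite sum of integer multiples of `u` is an integer multiple of `u`. -/
lemma exists_int_mul_eq_sum {ι : Type*} (s : Finset ι) (f : ι → ℝ) (u : ℝ)
    (hf : ∀ i ∈ s, ∃ m : ℤ, f i = m * u) : ∃ m : ℤ, ∑ i ∈ s, f i = m * u := by
  have hmem : ∑ i ∈ s, f i ∈ AddSubgroup.zmultiples u := by
    refine sum_mem fun i hi => ?_
    obtain ⟨m, hm⟩ := hf i hi
    exact AddSubgroup.mem_zmultiples_iff.mpr ⟨m, by rw [hm, zsmul_eq_mul]⟩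
  obtain ⟨m, hm⟩ := AddSubgroup.mem_zmultiples_iff.mp hmem
  exact ⟨m, by rw [← hm, zsmul_eq_mul]⟩

theorem stmt12 (n d : ℕ) (hd : 1 ≤ d) (γ : ℝ) (hγ : 0 < γ)
    (h h' : Finset (Fin n) → ℝ)
    (hmult : ∀ S : Finset (Fin n), S.card = d - 1 →
      ∃ m : ℤ, h' S = m * (γ / Nat.factorial d))
    (hclose : ∀ S : Finset (Fin n), S.card = d - 1 →
      |h' S - h S| < (0.1 / d) * (γ / Nat.factorial d)) :
    ∀ α : Finset (Fin n) → ℝ, (∀ T : Finset (Fin n), T.card = d → ∃ m : ℤ, α T = m * γ) →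
      ∑ T ∈ Finset.powersetCard d (Finset.univ : Finset (Fin n)),
          (∑ S ∈ Finset.powersetCard (d - 1) T, (h' S - h S)) ^ 2 ≤
        ∑ T ∈ Finset.powersetCard d (Finset.univ : Finset (Fin n)),
          (α T - ∑ S ∈ Finset.powersetCard (d - 1) T, h S) ^ 2 := by
  intro α hα
  refine Finset.sum_le_sum fun T hT => ?_
  have hTd : T.card = d := (Finset.mem_powersetCard.mp hT).2
  have hd0 : (d : ℝ) ≠ 0 := by exact_mod_cast (by omega : d ≠ 0)
  have hfac : (0 : ℝ) < Nat.factorial d := by exact_mod_cast Nat.factorial_pos d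
  have hu : 0 < γ / Nat.factorial d := by positivity
  have hcard : (Finset.powersetCard (d - 1) T).card = d := by
    rw [Finset.card_powersetCard, hTd, Nat.choose_symm hd, Nat.choose_one_right]
  obtain ⟨a, ha⟩ := hα T hTd
  obtain ⟨b, hb⟩ := exists_int_mul_eq_sum (Finset.powersetCard (d - 1) T) h' _
    fun S hS => hmult S (Finset.mem_powersetCard.mp hS).2
  have hsmall : |∑ S ∈ Finset.powersetCard (d - 1) T, (h' S - h S)| ≤
      γ / Nat.factorial d / 2 := by
    calc |∑ S ∈ Finset.powersetCard (d - 1) T, (h' S - h S)|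
        ≤ ∑ S ∈ Finset.powersetCard (d - 1) T, |h' S - h S| := Finset.abs_sum_le_sum_abs _ _
      _ ≤ (Finset.powersetCard (d - 1) T).card • ((0.1 / d) * (γ / Nat.factorial d)) :=
          Finset.sum_le_card_nsmul _ _ _ fun S hS =>
            (hclose S (Finset.mem_powersetCard.mp hS).2).le
      _ = 0.1 * (γ / Nat.factorial d) := by
          rw [hcard, nsmul_eq_mul, ← mul_assoc, mul_div_cancel₀ _ hd0]
      _ ≤ γ / Nat.factorial d / 2 := by linarith
  have hdiff : α T - ∑ S ∈ Finset.powersetCard (d - 1) T, h S =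
      ((a * Nat.factorial d - b : ℤ) : ℝ) * (γ / Nat.factorial d) +
        ∑ S ∈ Finset.powersetCard (d - 1) T, (h' S - h S) := by
    rw [Finset.sum_sub_distrib, hb, ha]
    push_cast
    field_simp
    ring
  rw [hdiff]
  exact sq_le_sq_int_mul_add _ hsmall
end

section
/- Let X be a real random variable on a probability space with E[X] = 0, E[X²] = σ² > 0, and E[X⁴] ≤ b·σ⁴ for some b > 0. Then P(X ≥ σ/(2√b)) > 0. -/
open MeasureTheory

theorem quartic_sub_quadratic_pos {x s t : ℝ} (hs : 0 < s) (ht : 0 < t) (hx : x < t) :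
    0 < x ^ 4 + 2 * s ^ 3 * (2 * t - x) - 3 * s ^ 2 * x ^ 2 := by
  have habs : |x| < 2 * t - x := by
    rw [abs_lt]
    constructor <;> linarith
  have hmul := mul_lt_mul_of_pos_left habs (by positivity : 0 < 2 * s ^ 3)
  have hfactor : 0 ≤ |x| * ((|x| - s) ^ 2 * (|x| + 2 * s)) := by positivity
  have hexpand : |x| * ((|x| - s) ^ 2 * (|x| + 2 * s))
      = x ^ 4 + 2 * s ^ 3 * |x| - 3 * s ^ 2 * x ^ 2 := by
    rw [← sq_abs x, ← (by decide : Even 4).pow_abs x]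
    ring
  linarith

theorem stmt15 {Ω : Type*} [MeasurableSpace Ω] (μ : Measure Ω) [IsProbabilityMeasure μ]
    (X : Ω → ℝ) (σ b : ℝ) (hσ : 0 < σ) (hb : 0 < b)
    (hmeas : Measurable X)
    (hint4 : Integrable (fun ω => X ω ^ 4) μ)
    (hE : ∫ ω, X ω ∂μ = 0)
    (hE2 : ∫ ω, X ω ^ 2 ∂μ = σ ^ 2)
    (hE4 : ∫ ω, X ω ^ 4 ∂μ ≤ b * σ ^ 4) :
    0 < μ {ω | σ / (2 * Real.sqrt b) ≤ X ω} := by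
  by_contra! hzero
  have hr : 0 < √b := Real.sqrt_pos.2 hb
  have hrb : √b ^ 2 = b := Real.sq_sqrt hb.le
  set t := σ / (2 * √b) with ht
  set s := σ * √b with hs
  have hint2 : Integrable (fun ω => X ω ^ 2) μ := by
    by_contra h
    rw [integral_undef h] at hE2
    exact (pow_pos hσ 2).ne hE2
  have hint : Integrable X μ :=
    ((memLp_two_iff_integrable_sq hmeas.aestronglyMeasurable).2 hint2).integrable one_le_two
  have hpos : ∀ᵐ ω ∂μ, 0 < X ω ^ 4 + 2 * s ^ 3 * (2 * t - X ω) - 3 * s ^ 2 * X ω ^ 2 := by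
    have hlt : ∀ᵐ ω ∂μ, ¬ t ≤ X ω := measure_eq_zero_iff_ae_notMem.1 (le_antisymm hzero bot_le)
    filter_upwards [hlt] with ω hω
    exact quartic_sub_quadratic_pos (by positivity) (by positivity) (not_le.1 hω)
  have hlin : Integrable (fun ω => 2 * s ^ 3 * (2 * t - X ω)) μ :=
    ((integrable_const _).sub hint).const_mul _
  have hsum : Integrable (fun ω => X ω ^ 4 + 2 * s ^ 3 * (2 * t - X ω)) μ := hint4.add hlin
  have hquad := hint2.const_mul (3 * s ^ 2)
  have hvalue : ∫ ω, (X ω ^ 4 + 2 * s ^ 3 * (2 * t - X ω) - 3 * s ^ 2 * X ω ^ 2) ∂μ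
      = ∫ ω, X ω ^ 4 ∂μ + 2 * s ^ 3 * (2 * t) - 3 * s ^ 2 * σ ^ 2 := by
    rw [integral_sub hsum hquad, integral_add hint4 hlin, integral_const_mul,
      integral_const_mul, integral_sub (integrable_const _) hint, hE, hE2]
    simp
  have hcoeff : 2 * s ^ 3 * (2 * t) - 3 * s ^ 2 * σ ^ 2 = -(b * σ ^ 4) := by
    have hst : s * (2 * t) = σ ^ 2 := by
      rw [hs, ht]
      field_simp
    have hs2 : s ^ 2 = b * σ ^ 2 := by rw [hs, mul_pow, hrb, mul_comm]
    linear_combination 2 * s ^ 2 * hst - σ ^ 2 * hs2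
  have hnonneg := hpos.mono fun ω hω => hω.le
  have hint_zero := (integral_eq_zero_iff_of_nonneg_ae hnonneg (hsum.sub hquad)).1
    (le_antisymm (by linarith) (integral_nonneg_of_ae hnonneg))
  obtain ⟨ω, hω, hω'⟩ := (hpos.and hint_zero).exists
  exact hω.ne' hω'
end

section
/- Let 1 ≤ j ≤ n and let g : {T ⊆ [n] : |T| = j} → ℝ satisfy Σ_{i ∉ T'} g(T' ∪ {i}) = 0 for every T' ⊆ [n] with |T'| = j−1. Then for every S ⊆ [n] with |S| < j, Σ_{T ⊇ S, |T| = j} g(T) = 0. -/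
open Finset

/-- Double counting of the pairs `(T, i)` with `S ⊆ T`, `#T = k + 1` and `i ∈ T \ S`. -/
theorem sum_powersetCard_superset_sum_insert {α M : Type*} [Fintype α] [DecidableEq α]
    [AddCommMonoid M] (k : ℕ) (S : Finset α) (g : Finset α → M) :
    ∑ U ∈ (powersetCard k univ).filter (fun U => S ⊆ U), ∑ i ∈ Uᶜ, g (insert i U) =
      ∑ T ∈ (powersetCard (k + 1) univ).filter (fun T => S ⊆ T), (k + 1 - #S) • g T := by
  have hcard : ∀ T ∈ (powersetCard (k + 1) (univ : Finset α)).filter (fun T => S ⊆ T),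
      (k + 1 - #S) • g T = ∑ _i ∈ T \ S, g T := by
    intro T hT
    simp only [mem_filter, mem_powersetCard_univ] at hT
    rw [sum_const, card_sdiff_of_subset hT.2, hT.1]
  rw [sum_congr rfl hcard, sum_sigma', sum_sigma']
  refine sum_bij' (fun x _ => ⟨insert x.2 x.1, x.2⟩) (fun y _ => ⟨y.1.erase y.2, y.2⟩)
    ?_ ?_ ?_ ?_ ?_
  · rintro ⟨U, i⟩ h
    simp only [mem_sigma, mem_filter, mem_powersetCard_univ, mem_compl] at h
    obtain ⟨⟨hU, hS⟩, hi⟩ := h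
    simp only [mem_sigma, mem_filter, mem_powersetCard_univ, mem_sdiff]
    exact ⟨⟨by rw [card_insert_of_notMem hi, hU], hS.trans (subset_insert i U)⟩,
      mem_insert_self i U, fun h => hi (hS h)⟩
  · rintro ⟨T, i⟩ h
    simp only [mem_sigma, mem_filter, mem_powersetCard_univ, mem_sdiff] at h
    obtain ⟨⟨hT, hS⟩, hi, hiS⟩ := h
    simp only [mem_sigma, mem_filter, mem_powersetCard_univ, mem_compl]
    exact ⟨⟨by rw [card_erase_of_mem hi, hT, Nat.add_sub_cancel],
      subset_erase.2 ⟨hS, hiS⟩⟩, notMem_erase i T⟩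
  · rintro ⟨U, i⟩ h
    simp only [mem_sigma, mem_compl] at h
    simp [erase_insert h.2]
  · rintro ⟨T, i⟩ h
    simp only [mem_sigma, mem_sdiff] at h
    simp [insert_erase h.2.1]
  · intro _ _
    rfl

theorem stmt16 (n j : ℕ) (hj1 : 1 ≤ j) (hjn : j ≤ n)
    (g : Finset (Fin n) → ℝ)
    (hg : ∀ T' : Finset (Fin n), T'.card = j - 1 →
      ∑ i ∈ T'ᶜ, g (insert i T') = 0) :
    ∀ S : Finset (Fin n), S.card < j →
      ∑ T ∈ (Finset.powersetCard j (Finset.univ : Finset (Fin n))).filter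
          (fun T => S ⊆ T), g T = 0 := by
  intro S hS
  obtain ⟨k, rfl⟩ := Nat.exists_eq_add_of_le' hj1
  have hsum := sum_powersetCard_superset_sum_insert k S g
  rw [sum_eq_zero fun U hU => hg U (by simpa using (mem_filter.1 hU).1), ← smul_sum] at hsum
  exact (smul_eq_zero.1 hsum.symm).resolve_left (Nat.sub_ne_zero_of_lt hS)
end

section
/- Let n be even and let D denote the uniform distribution on {x ∈ {−1,1}^n : Σ_{i=1}^n x_i = 0}. For every S ⊆ [n]: if |S| is odd then E_D[Π_{i∈S} x_i] = 0; and if |S| = k is even with 2 ≤ k ≤ n, then E_D[Π_{i∈S} x_i] = (−1)^{k/2} · (k−1)!! / ((n−1)(n−3)⋯(n−k+1)), where (k−1)!! = (k−1)(k−3)⋯1 and the denominator is the product of n−1, n−3, …, n−k+1. -/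
open Finset

/-- The (integer) sum of the ±1 values of an assignment. -/
def intSum {n : ℕ} (σ : Fin n → Bool) : ℤ := ∑ i, (if σ i then (1 : ℤ) else -1)

/-- The set of assignments satisfying the bisection constraint `∑ i x i = 0`. -/
def bisSet (n : ℕ) : Finset (Fin n → Bool) := Finset.univ.filter fun σ => intSum σ = 0

lemma mem_bisSet {n : ℕ} {σ : Fin n → Bool} : σ ∈ bisSet n ↔ intSum σ = 0 := by
  simp [bisSet]

lemma sum_signs {n : ℕ} (σ : Fin n → Bool) : ∑ i, signs σ i = (intSum σ : ℝ) := by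
  simp [signs, intSum]

lemma intSum_not {n : ℕ} (σ : Fin n → Bool) : intSum (fun i => !σ i) = -intSum σ := by
  unfold intSum
  rw [← Finset.sum_neg_distrib]
  refine Finset.sum_congr rfl fun i _ => ?_
  cases h : σ i <;> simp [h]

lemma not_mem_bisSet {n : ℕ} {σ : Fin n → Bool} (hσ : σ ∈ bisSet n) :
    (fun i => !σ i) ∈ bisSet n := by
  rw [mem_bisSet] at hσ ⊢
  rw [intSum_not, hσ, neg_zero]

lemma bisSet_nonempty {n : ℕ} (hn : Even n) : (bisSet n).Nonempty := by
  obtain ⟨m, rfl⟩ := hn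
  refine ⟨fun i => decide ((i : ℕ) < m), mem_bisSet.2 ?_⟩
  simp [intSum, Fin.sum_univ_add]

/-- The unnormalised moment of the monomial indexed by `S` over the balanced assignments. -/
noncomputable def bisMoment {n : ℕ} (S : Finset (Fin n)) : ℝ :=
  ∑ σ ∈ bisSet n, ∏ i ∈ S, signs σ i

lemma bisMoment_eq_zero_of_odd {n : ℕ} {S : Finset (Fin n)} (hS : Odd S.card) :
    bisMoment S = 0 := by
  have h : bisMoment S = -bisMoment S := by
    unfold bisMoment
    rw [← Finset.sum_neg_distrib]
    refine Finset.sum_nbij' (fun σ i => !σ i) (fun σ i => !σ i)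
      (fun _ => not_mem_bisSet) (fun _ => not_mem_bisSet) (by simp) (by simp) ?_
    intro σ _
    have hneg : ∀ i, signs (fun i => !σ i) i = -signs σ i := fun i => by
      cases h : σ i <;> simp [signs, h]
    simp [hneg, Finset.prod_neg, hS.neg_one_pow]
  linarith

lemma bisMoment_map_perm {n : ℕ} (e : Equiv.Perm (Fin n)) (S : Finset (Fin n)) :
    bisMoment (S.map e.toEmbedding) = bisMoment S := by
  unfold bisMoment
  have hinv : ∀ (e : Equiv.Perm (Fin n)) (σ : Fin n → Bool), σ ∈ bisSet n → σ ∘ e ∈ bisSet n := by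
    intro e σ hσ
    rw [mem_bisSet] at hσ ⊢
    rw [← hσ]
    exact Equiv.sum_comp e fun i => if σ i then (1 : ℤ) else -1
  refine Finset.sum_nbij' (fun σ => σ ∘ e) (fun σ => σ ∘ e.symm) (hinv e) (hinv e.symm) ?_ ?_ ?_
  · intro σ _; ext; simp
  · intro σ _; ext; simp
  · intro σ _; simp [signs]

lemma bisMoment_congr_card {n : ℕ} {S T : Finset (Fin n)} (h : S.card = T.card) :
    bisMoment S = bisMoment T := by
  obtain ⟨e, he⟩ : ∃ e : Equiv.Perm (Fin n), S.map e.toEmbedding = T := by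
    let f : {x // x ∈ S} ≃ {x // x ∈ T} := Finset.equivOfCardEq h
    refine ⟨f.extendSubtype, Finset.eq_of_subset_of_card_le ?_ (by simp [h])⟩
    intro x hx
    obtain ⟨y, hy, rfl⟩ := Finset.mem_map.1 hx
    exact f.extendSubtype_mem y hy
  rw [← he, bisMoment_map_perm]

lemma sum_bisMoment_erase_add_insert {n : ℕ} (T : Finset (Fin n)) :
    ∑ i ∈ T, bisMoment (T.erase i) + ∑ i ∈ Tᶜ, bisMoment (insert i T) = 0 := by
  have h : ∑ σ ∈ bisSet n, (∑ i, signs σ i) * ∏ j ∈ T, signs σ j = 0 := by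
    refine Finset.sum_eq_zero fun σ hσ => ?_
    rw [sum_signs, mem_bisSet.1 hσ, Int.cast_zero, zero_mul]
  rw [← h]
  simp_rw [Finset.sum_mul]
  rw [Finset.sum_comm, ← Finset.sum_add_sum_compl T]
  congr 1
  · refine Finset.sum_congr rfl fun i hi => Finset.sum_congr rfl fun σ _ => ?_
    rw [← Finset.mul_prod_erase T _ hi, ← mul_assoc, signs_mul_self, one_mul]
  · refine Finset.sum_congr rfl fun i hi => Finset.sum_congr rfl fun σ _ => ?_
    rw [Finset.prod_insert (Finset.mem_compl.1 hi)]

lemma bisMoment_mul_prod {n : ℕ} (p : ℕ) {S : Finset (Fin n)} (hS : S.card = 2 * p) :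
    bisMoment S * ∏ j ∈ Finset.range p, ((n : ℝ) - 1 - 2 * j) =
      (-1) ^ p * (Nat.doubleFactorial (2 * p - 1) : ℝ) * (bisSet n).card := by
  induction p generalizing S with
  | zero =>
    obtain rfl : S = ∅ := by simpa using hS
    simp [bisMoment]
  | succ p ih =>
    obtain ⟨a, ha⟩ : S.Nonempty := Finset.card_pos.1 (by omega)
    have hT : (S.erase a).card = 2 * p + 1 := by rw [Finset.card_erase_of_mem ha]; omega
    obtain ⟨b, hb⟩ : (S.erase a).Nonempty := Finset.card_pos.1 (by omega)
    have hU : ((S.erase a).erase b).card = 2 * p := by rw [Finset.card_erase_of_mem hb]; omega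
    have hrec := sum_bisMoment_erase_add_insert (S.erase a)
    rw [Finset.sum_congr rfl fun i hi => bisMoment_congr_card
        (T := (S.erase a).erase b) (by rw [Finset.card_erase_of_mem hi, hU, hT]; rfl),
      Finset.sum_congr (s₁ := (S.erase a)ᶜ) rfl fun i hi => bisMoment_congr_card
        (T := S) (by rw [Finset.card_insert_of_notMem (Finset.mem_compl.1 hi), hT, hS]; ring),
      Finset.sum_const, Finset.sum_const, Finset.card_compl, hT, Fintype.card_fin,
      nsmul_eq_mul, nsmul_eq_mul] at hrec
    have hle : 2 * p + 1 ≤ n := by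
      have := Finset.card_le_univ S
      rw [Fintype.card_fin] at this
      omega
    have hdf : Nat.doubleFactorial (2 * (p + 1) - 1) =
        (2 * p + 1) * Nat.doubleFactorial (2 * p - 1) := by
      cases p with
      | zero => rfl
      | succ q => exact Nat.doubleFactorial_add_two (2 * q + 1)
    have hih := ih hU
    rw [Finset.prod_range_succ, hdf]
    push_cast [hle] at hrec ⊢
    rw [pow_succ]
    linear_combination (∏ j ∈ Finset.range p, ((n : ℝ) - 1 - 2 * j)) * hrec - (2 * p + 1) * hih

theorem stmt17 (n : ℕ) (hn : Even n) (S : Finset (Fin n)) :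
    (Odd S.card → expOver (bisSet n) (fun σ => ∏ i ∈ S, signs σ i) = 0) ∧
    (∀ k : ℕ, S.card = k → Even k → 2 ≤ k → k ≤ n →
      expOver (bisSet n) (fun σ => ∏ i ∈ S, signs σ i) =
        (-1 : ℝ) ^ (k / 2) * (Nat.doubleFactorial (k - 1) : ℝ) /
          ∏ j ∈ Finset.range (k / 2), ((n : ℝ) - 1 - 2 * j)) := by
  refine ⟨fun hS => ?_, ?_⟩
  · change bisMoment S / _ = 0
    rw [bisMoment_eq_zero_of_odd hS, zero_div]
  · rintro k hS ⟨p, rfl⟩ - hk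
    have hp : (p + p) / 2 = p := by omega
    have hcard : ((bisSet n).card : ℝ) ≠ 0 :=
      Nat.cast_ne_zero.2 (Finset.card_pos.2 (bisSet_nonempty hn)).ne'
    have hprod : ∏ j ∈ Finset.range p, ((n : ℝ) - 1 - 2 * j) ≠ 0 := by
      refine Finset.prod_ne_zero_iff.2 fun j hj => ?_
      have hj' : 2 * j + 2 ≤ n := by have := Finset.mem_range.1 hj; omega
      have : (2 * j + 2 : ℝ) ≤ n := mod_cast hj'
      linarith
    change bisMoment S / _ = _
    rw [hp, div_eq_div_iff hcard hprod, ← two_mul]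
    exact bisMoment_mul_prod p (hS.trans (two_mul p).symm)
end

section
/- Let d ≥ 1, n ≥ 3d, and p ∈ (0,1). Let f be a multilinear polynomial of degree at most d on n variables, and let S ⊆ [n] with |S| ≥ d. Suppose h₁ and h₂ are multilinear polynomials of degree at most d−1 such that, for each k ∈ {1,2}, every variable i ∈ S is inactive in the multilinear expansion of f − (Σ_{j=1}^n x_j − (1−2p)n)·h_k. Then h₁ = h₂ (all their coefficients coincide). -/
open Finset

/-- The character `∏ i ∈ T, x i` at the point whose coordinates equal to `-1` are those in `X`. -/
noncomputable def walsh {n : ℕ} (T X : Finset (Fin n)) : ℝ :=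
  ∏ i, if i ∈ T ∧ i ∈ X then -1 else 1

/-- The value of the multilinear polynomial with coefficients `h` at the point whose coordinates
equal to `-1` are those in `X`. -/
noncomputable def walshEval {n : ℕ} (h : Finset (Fin n) → ℝ) (X : Finset (Fin n)) : ℝ :=
  ∑ T, h T * walsh T X

section Walsh

variable {n : ℕ}

lemma walsh_comm (T X : Finset (Fin n)) : walsh T X = walsh X T := by
  simp only [walsh, and_comm]

lemma walsh_symmDiff_right (T X Y : Finset (Fin n)) :
    walsh T (symmDiff X Y) = walsh T X * walsh T Y := by
  simp only [walsh, ← prod_mul_distrib]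
  refine prod_congr rfl fun i _ => ?_
  by_cases hT : i ∈ T <;> by_cases hX : i ∈ X <;> by_cases hY : i ∈ Y <;>
    simp [hT, hX, hY, mem_symmDiff]

lemma walsh_symmDiff_left (T U X : Finset (Fin n)) :
    walsh (symmDiff T U) X = walsh T X * walsh U X := by
  rw [walsh_comm, walsh_symmDiff_right, walsh_comm X T, walsh_comm X U]

lemma walsh_eq_prod (T X : Finset (Fin n)) :
    walsh T X = ∏ i ∈ X, if i ∈ T then (-1 : ℝ) else 1 := by
  rw [walsh, ← prod_subset (subset_univ X)]
  · exact prod_congr rfl fun i hi => by simp [hi]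
  · intro i _ hi
    simp [hi]

lemma walsh_of_disjoint {T X : Finset (Fin n)} (h : Disjoint T X) : walsh T X = 1 := by
  rw [walsh_eq_prod]
  exact prod_eq_one fun i hi => if_neg (disjoint_right.mp h hi)

lemma walsh_singleton (i : Fin n) (X : Finset (Fin n)) :
    walsh {i} X = if i ∈ X then -1 else 1 := by
  rw [walsh_comm, walsh_eq_prod, prod_singleton]

lemma sum_walsh_singleton (X : Finset (Fin n)) : ∑ i, walsh {i} X = n - 2 * (#X : ℝ) := by
  have h (i : Fin n) : walsh {i} X = 1 - 2 * if i ∈ X then (1 : ℝ) else 0 := by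
    rw [walsh_singleton]
    split_ifs <;> norm_num
  simp [h, sum_sub_distrib, mul_comm]

/-- Orthogonality of the characters. -/
lemma sum_walsh_mul_walsh (T U : Finset (Fin n)) :
    ∑ X, walsh T X * walsh U X = if T = U then 2 ^ n else 0 := by
  have h : ∑ X, walsh T X * walsh U X =
      ∏ i, (1 + if i ∈ symmDiff T U then (-1 : ℝ) else 1) := by
    rw [prod_one_add, powerset_univ]
    exact sum_congr rfl fun X _ => by rw [← walsh_symmDiff_left, walsh_eq_prod]
  rw [h]
  split_ifs with hTU
  · subst hTU
    norm_num
  · obtain ⟨i, hi⟩ : (symmDiff T U).Nonempty := by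
      rw [nonempty_iff_ne_empty]
      simpa using hTU
    exact prod_eq_zero (mem_univ i) (by simp [hi])

lemma eq_zero_of_walshEval_eq_zero {h : Finset (Fin n) → ℝ} (hh : ∀ X, walshEval h X = 0) :
    h = 0 := by
  funext U
  have key : ∑ X, walshEval h X * walsh U X = h U * 2 ^ n := by
    simp only [walshEval, sum_mul]
    rw [sum_comm]
    simp [mul_assoc, ← mul_sum, sum_walsh_mul_walsh]
  simpa [hh] using key.symm

/-- Evaluation turns multiplication by `∑ i, x i` into multiplication by its value. -/
lemma walshEval_mulSum (h : Finset (Fin n) → ℝ) (X : Finset (Fin n)) :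
    walshEval (mulSum h) X = (n - 2 * (#X : ℝ)) * walshEval h X := by
  rw [← sum_walsh_singleton, walshEval, walshEval, sum_mul]
  simp only [mulSum, sum_mul]
  rw [sum_comm]
  refine sum_congr rfl fun i _ => ?_
  rw [mul_sum, ← Equiv.sum_comp (symmDiff_right_involutive {i}).toPerm]
  refine sum_congr rfl fun T _ => ?_
  simp only [Function.Involutive.coe_toPerm, walsh_symmDiff_left, symmDiff_symmDiff_cancel_right,
    symmDiff_comm {i} T]
  ring

lemma walshEval_mulSum_sub (h : Finset (Fin n) → ℝ) (a : ℝ) (X : Finset (Fin n)) :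
    walshEval (fun T => mulSum h T - a * h T) X = (n - 2 * (#X : ℝ) - a) * walshEval h X := by
  rw [sub_mul, ← walshEval_mulSum]
  simp only [walshEval, sub_mul, sum_sub_distrib, mul_sum, mul_assoc]

/-- A polynomial in which the variables of `B` are inactive is invariant under flipping `B`. -/
lemma walshEval_symmDiff {g : Finset (Fin n) → ℝ} {B : Finset (Fin n)}
    (hg : ∀ i ∈ B, ∀ T, i ∈ T → g T = 0) (X : Finset (Fin n)) :
    walshEval g (symmDiff X B) = walshEval g X := by
  refine sum_congr rfl fun T _ => ?_
  by_cases h : Disjoint T B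
  · rw [walsh_symmDiff_right, walsh_of_disjoint h, mul_one]
  · obtain ⟨i, hT, hB⟩ := not_disjoint_iff.mp h
    rw [hg i hB T hT, zero_mul, zero_mul]

/-- The discrete derivative along `A` kills polynomials of degree less than `#A`. -/
lemma sum_powerset_walshEval {h : Finset (Fin n) → ℝ} {A : Finset (Fin n)}
    (hh : ∀ T, #A ≤ #T → h T = 0) (X : Finset (Fin n)) :
    ∑ B ∈ A.powerset, (-1) ^ #B * walshEval h (symmDiff X B) = 0 := by
  simp only [walshEval, mul_sum]
  rw [sum_comm]
  refine sum_eq_zero fun T _ => ?_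
  rcases le_or_gt #A #T with hT | hT
  · simp [hh T hT]
  · obtain ⟨i, hiA, hiT⟩ := exists_mem_notMem_of_card_lt_card hT
    have h0 : ∏ i ∈ A, (1 + -1 * if i ∈ T then (-1 : ℝ) else 1) = 0 :=
      prod_eq_zero hiA (by simp [hiT])
    rw [prod_one_add] at h0
    calc _ = h T * walsh T X *
          ∑ B ∈ A.powerset, ∏ i ∈ B, (-1 * if i ∈ T then (-1 : ℝ) else 1) := by
          rw [mul_sum]
          refine sum_congr rfl fun B _ => ?_
          rw [prod_mul_distrib, ← walsh_eq_prod, prod_const, walsh_symmDiff_right]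
          ring
      _ = 0 := by rw [h0, mul_zero]

end Walsh

/-- Iterated differences of `k ↦ 1 / (c - 2 * k)`. -/
lemma fwdDiff_iter_inv_linear {d : ℕ} {c : ℝ} {F : ℕ → ℝ}
    (hF : ∀ k ≤ d, F k * (c - 2 * k) = 1) (j m : ℕ) (hj : m + j ≤ d) :
    (fwdDiff 1)^[j] F m = j.factorial * 2 ^ j * ∏ k ∈ range (j + 1), F (m + k) := by
  induction j generalizing m with
  | zero => simp
  | succ j ih =>
    have shift (k : ℕ) : m + 1 + k = m + (k + 1) := by ring
    have hlow : ∏ k ∈ range (j + 1), F (m + k) = (∏ k ∈ range j, F (m + (k + 1))) * F m := by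
      rw [prod_range_succ', add_zero]
    rw [Function.iterate_succ_apply', fwdDiff, ih m (by omega), ih (m + 1) (by omega),
      prod_range_succ _ (j + 1), hlow, prod_range_succ]
    simp only [shift]
    have h1 := hF m (by omega)
    have h2 := hF (m + (j + 1)) hj
    rw [Nat.factorial_succ]
    push_cast at h2 ⊢
    have h3 : F (m + (j + 1)) - F m = 2 * (j + 1) * (F (m + (j + 1)) * F m) := by
      linear_combination (-F (m + (j + 1))) * h1 + F m * h2
    linear_combination (j.factorial * 2 ^ j * ∏ k ∈ range j, F (m + (k + 1))) * h3

lemma sum_choose_inv_linear_ne_zero {d : ℕ} {c : ℝ} {F : ℕ → ℝ}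
    (hF : ∀ k ≤ d, F k * (c - 2 * k) = 1) :
    ∑ k ∈ range (d + 1), (d.choose k : ℝ) * ((-1) ^ k * F k) ≠ 0 := by
  have h := fwdDiff_iter_inv_linear hF d 0 (by omega)
  rw [fwdDiff_iter_eq_sum_shift] at h
  intro h0
  have h1 : ∏ k ∈ range (d + 1), F (0 + k) ≠ 0 := by
    refine prod_ne_zero_iff.mpr fun k hk => ?_
    rw [zero_add]
    exact left_ne_zero_of_mul_eq_one (hF k (by simpa [Nat.lt_succ_iff] using hk))
  have h2 : (d.factorial : ℝ) * 2 ^ d * ∏ k ∈ range (d + 1), F (0 + k) ≠ 0 :=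
    mul_ne_zero (mul_ne_zero (by exact_mod_cast d.factorial_ne_zero) (by positivity)) h1
  rw [← h] at h2
  refine h2 ?_
  rw [← mul_zero ((-1 : ℝ) ^ d), ← h0, mul_sum]
  refine sum_congr rfl fun k hk => ?_
  have hk' : k ≤ d := by simpa [Nat.lt_succ_iff] using hk
  have h3 : (-1 : ℝ) ^ (d - k) = (-1) ^ d * (-1) ^ k := by
    obtain ⟨e, rfl⟩ := Nat.exists_eq_add_of_le hk'
    rw [Nat.add_sub_cancel_left, pow_add, mul_right_comm, ← mul_pow]
    simp
  simp [h3]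
  ring

/-- If multiplying a polynomial `h` of degree less than `d` by `∑ i, x i - a` gives a polynomial not
involving some `d` of the variables, then the product vanishes. -/
lemma mul_walshEval_eq_zero {n d : ℕ} {a : ℝ} {h : Finset (Fin n) → ℝ} {A : Finset (Fin n)}
    (hA : #A = d) (hdeg : ∀ T, d ≤ #T → h T = 0)
    (hin : ∀ i ∈ A, ∀ T : Finset (Fin n), i ∈ T → mulSum h T - a * h T = 0)
    (X : Finset (Fin n)) : (n - 2 * (#X : ℝ) - a) * walshEval h X = 0 := by
  have hinv (X B : Finset (Fin n)) (hB : B ⊆ A) :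
      (n - 2 * (#(symmDiff X B) : ℝ) - a) * walshEval h (symmDiff X B) =
        (n - 2 * (#X : ℝ) - a) * walshEval h X := by
    rw [← walshEval_mulSum_sub, ← walshEval_mulSum_sub]
    exact walshEval_symmDiff (fun i hi => hin i (hB hi)) X
  wlog hX : Disjoint X A generalizing X
  · rw [← hinv X (X ∩ A) inter_subset_right]
    refine this _ (disjoint_left.mpr fun i hi hiA => ?_)
    simp [mem_symmDiff, hiA] at hi
  by_contra hg
  set g := (n - 2 * (#X : ℝ) - a) * walshEval h X with hgdef
  have hcard (B : Finset (Fin n)) (hB : B ⊆ A) :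
      (n - 2 * (#X : ℝ) - a - 2 * #B) * walshEval h (symmDiff X B) = g := by
    rw [hgdef, ← hinv X B hB, (hX.mono_right hB).symmDiff_eq_sup, sup_eq_union,
      card_union_of_disjoint (hX.mono_right hB)]
    push_cast
    ring
  have hne (k : ℕ) (hk : k ≤ d) : n - 2 * (#X : ℝ) - a - 2 * k ≠ 0 := by
    obtain ⟨B, hB, rfl⟩ := exists_subset_card_eq (hA ▸ hk)
    exact left_ne_zero_of_mul (hcard B hB ▸ hg)
  refine sum_choose_inv_linear_ne_zero (d := d) (c := n - 2 * (#X : ℝ) - a)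
    (F := fun k => (n - 2 * (#X : ℝ) - a - 2 * k)⁻¹)
    (fun k hk => inv_mul_cancel₀ (hne k hk)) ?_
  have hsum := sum_powerset_walshEval (A := A) (fun T hT => hdeg T (hA ▸ hT)) X
  have hsum' : ∑ B ∈ A.powerset, (-1 : ℝ) ^ #B * walshEval h (symmDiff X B) =
      g * ∑ B ∈ A.powerset, (-1 : ℝ) ^ #B * (n - 2 * (#X : ℝ) - a - 2 * #B)⁻¹ := by
    rw [mul_sum]
    refine sum_congr rfl fun B hB => ?_
    have hB := mem_powerset.mp hB
    have := hne #B (hA ▸ card_le_card hB)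
    rw [← hcard B hB]
    field_simp
  rw [hsum', mul_eq_zero, or_iff_right hg,
    sum_powerset_apply_card (fun k : ℕ => (-1 : ℝ) ^ k * (n - 2 * (#X : ℝ) - a - 2 * k)⁻¹), hA]
    at hsum
  simpa using hsum

/-- A polynomial of degree less than `d` supported on a slice of the cube vanishes. -/
lemma walshEval_eq_zero_of_slice {n d : ℕ} (hn : 2 * d ≤ n) {a : ℝ} {h : Finset (Fin n) → ℝ}
    (hdeg : ∀ T, d ≤ #T → h T = 0)
    (hmul : ∀ X : Finset (Fin n), (n - 2 * (#X : ℝ) - a) * walshEval h X = 0)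
    (X : Finset (Fin n)) : walshEval h X = 0 := by
  rcases mul_eq_zero.mp (hmul X) with hX | hX
  swap
  · exact hX
  obtain ⟨A, hA, hflip⟩ : ∃ A : Finset (Fin n), #A = d ∧
      ∀ B ⊆ A, B ≠ ∅ → #(symmDiff X B) ≠ #X := by
    rcases le_or_gt d #X with hd | hd
    · obtain ⟨A, hAX, hA⟩ := exists_subset_card_eq hd
      refine ⟨A, hA, fun B hB hne => ?_⟩
      have hBX := hB.trans hAX
      rw [symmDiff_of_ge hBX, card_sdiff_of_subset hBX]
      have := card_pos.mpr (nonempty_iff_ne_empty.mpr hne)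
      have := card_le_card hBX
      omega
    · have hc : d ≤ #Xᶜ := by
        rw [card_compl, Fintype.card_fin]
        omega
      obtain ⟨A, hAX, hA⟩ := exists_subset_card_eq hc
      refine ⟨A, hA, fun B hB hne => ?_⟩
      have hBX : Disjoint X B := disjoint_compl_right.mono_right (hB.trans hAX)
      rw [hBX.symmDiff_eq_sup, sup_eq_union, card_union_of_disjoint hBX]
      have := card_pos.mpr (nonempty_iff_ne_empty.mpr hne)
      omega
  have hsum := sum_powerset_walshEval (A := A) (fun T hT => hdeg T (hA ▸ hT)) X
  rw [sum_eq_single_of_mem ∅ (empty_mem_powerset A)] at hsum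
  · simpa [← bot_eq_empty] using hsum
  · intro B hB hne
    refine mul_eq_zero_of_right _ ((mul_eq_zero.mp (hmul (symmDiff X B))).resolve_left fun h0 => ?_)
    refine hflip B (mem_powerset.mp hB) hne ?_
    have : (#(symmDiff X B) : ℝ) = #X := by linarith
    exact_mod_cast this

theorem stmt18 (n d : ℕ) (hd : 1 ≤ d) (hn : 3 * d ≤ n)
    (p : ℝ) (hp1 : 0 < p) (hp2 : p < 1)
    (c : Finset (Fin n) → ℝ) (hdeg : ∀ S, d < S.card → c S = 0)
    (S : Finset (Fin n)) (hS : d ≤ S.card)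
    (h₁ h₂ : Finset (Fin n) → ℝ)
    (hdeg1 : ∀ T, d - 1 < T.card → h₁ T = 0)
    (hdeg2 : ∀ T, d - 1 < T.card → h₂ T = 0)
    (hin1 : ∀ i ∈ S, ∀ T : Finset (Fin n), i ∈ T →
      c T - (mulSum h₁ T - (1 - 2 * p) * n * h₁ T) = 0)
    (hin2 : ∀ i ∈ S, ∀ T : Finset (Fin n), i ∈ T →
      c T - (mulSum h₂ T - (1 - 2 * p) * n * h₂ T) = 0) :
    h₁ = h₂ := by
  obtain ⟨A, hAS, hA⟩ := exists_subset_card_eq hS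
  have hdeg' (T : Finset (Fin n)) (hT : d ≤ #T) : (h₁ - h₂) T = 0 := by
    rw [Pi.sub_apply, hdeg1 T (by omega), hdeg2 T (by omega), sub_zero]
  have hin (i : Fin n) (hi : i ∈ A) (T : Finset (Fin n)) (hT : i ∈ T) :
      mulSum (h₁ - h₂) T - (1 - 2 * p) * n * (h₁ - h₂) T = 0 := by
    have e : mulSum (h₁ - h₂) T = mulSum h₁ T - mulSum h₂ T := by
      simp [mulSum, sum_sub_distrib]
    rw [e, Pi.sub_apply]
    linear_combination hin2 i (hAS hi) T hT - hin1 i (hAS hi) T hT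
  exact sub_eq_zero.mp <| eq_zero_of_walshEval_eq_zero <|
    walshEval_eq_zero_of_slice (by omega) hdeg' (mul_walshEval_eq_zero hA hdeg' hin)
end
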